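/- Let I ⊆ R be an S_n-invariant monomial ideal. Then a pair (i,λ) ∈ [n]×P_n is extremal in the Betti table of R/I if and only if it is Ext-extremal. Moreover, for an extremal pair (i,λ) one has β_{i,λ}(R/I) = dim_k Ext^i(R/I,R)_{−λ}, the dimension of the component of Ext^i(R/I,R) in multidegree −λ. -/

import Mathlib

open scoped BigOperators

noncomputable section
open Classical

/-! ## Generic (labeled) simplicial chain complexes and reduced homology over a field -/

section Homology

variable (K : Type) [Field K] {α : Type}

/-- Index type for chains: elements of `S` whose face (second component) has `j` elements. -/
def ChainIdx (S : Set (α × Finset ℕ)) (j : ℕ) : Type :=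
  {q : α × Finset ℕ // q ∈ S ∧ q.2.card = j}

/-- The boundary of a basis element, with the usual simplicial signs. -/
noncomputable def bdElt (S : Set (α × Finset ℕ)) (j : ℕ) (q : ChainIdx S (j + 1)) :
    ChainIdx S j →₀ K :=
  ∑ v ∈ q.1.2,
    if h : (q.1.1, q.1.2.erase v) ∈ S ∧ (q.1.2.erase v).card = j then
      ((-1 : K) ^ (q.1.2.filter (fun u => u ≤ v)).card) •
        Finsupp.single (⟨(q.1.1, q.1.2.erase v), h⟩ : ChainIdx S j) (1 : K)
    else 0

/-- The simplicial boundary map. -/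
noncomputable def bd (S : Set (α × Finset ℕ)) (j : ℕ) :
    (ChainIdx S (j + 1) →₀ K) →ₗ[K] (ChainIdx S j →₀ K) :=
  Finsupp.linearCombination K (bdElt K S j)

/-- Cycles in homological degree `j` (chains are indexed by the cardinality of faces;
degree `j` corresponds to reduced topological degree `j - 1`). -/
noncomputable def cycles (S : Set (α × Finset ℕ)) : (j : ℕ) → Submodule K (ChainIdx S j →₀ K)
  | 0 => ⊤
  | (i + 1) => LinearMap.ker (bd K S i)

/-- `rhd K S j` is the dimension of the reduced homology group `H̃_{j-1}` of the complex `S`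
(the chain groups being finite dimensional, this is `dim` cycles `- dim` boundaries). -/
noncomputable def rhd (S : Set (α × Finset ℕ)) (j : ℕ) : ℕ :=
  Module.finrank K (cycles K S j) -
    Module.finrank K (LinearMap.range (bd K S j) ⊓ cycles K S j : Submodule K _)

/-- `hdim K S j = dim_K H̃_j(S; K)`, for `j : ℤ` (zero for `j ≤ -2`). -/
noncomputable def hdim (S : Set (α × Finset ℕ)) (j : ℤ) : ℕ :=
  if 0 ≤ j + 1 then rhd K S (j + 1).toNat else 0

/-- View an unlabeled collection of faces as a labeled one (labels in `Unit`). -/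
def lab (Δ : Set (Finset ℕ)) : Set (Unit × Finset ℕ) := {q | q.2 ∈ Δ}

/-- Dimension of reduced homology `H̃_{j-1}(Δ; K)` of a collection `Δ` of finite sets. -/
noncomputable def rhd0 (Δ : Set (Finset ℕ)) (j : ℕ) : ℕ := rhd K (lab Δ) j

/-- Dimension of reduced homology `H̃_j(Δ; K)`, `j : ℤ`. -/
noncomputable def hdim0 (Δ : Set (Finset ℕ)) (j : ℤ) : ℕ := hdim K (lab Δ) j

end Homology

/-! ## Monomial ideals in `k[x_1, …, x_n]`, invariant under the symmetric group -/

section Poly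

variable (K : Type) [Field K] (n : ℕ)

/-- The monomial `x^a` in `k[x_1, …, x_n]`. -/
noncomputable def mon (a : Fin n → ℕ) : MvPolynomial (Fin n) K :=
  MvPolynomial.monomial (Finsupp.equivFunOnFinite.symm a) 1

/-- A monomial ideal: an ideal generated by a set of monomials. -/
def IsMonomialIdeal (I : Ideal (MvPolynomial (Fin n) K)) : Prop :=
  ∃ S : Set (Fin n → ℕ), I = Ideal.span (mon K n '' S)

/-- `I` is invariant under the action of `S_n` permuting the variables. -/
def IsSymmetricIdeal (I : Ideal (MvPolynomial (Fin n) K)) : Prop :=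
  ∀ σ : Equiv.Perm (Fin n), Ideal.map (MvPolynomial.rename σ).toRingHom I = I

end Poly

/-! ## Partitions given by blocks `(d_1^{p_1}, …, d_s^{p_s}, 0^{p_{s+1}})` -/

section Blocks

/-- `cumsum p k = p 0 + ⋯ + p (k-1)`. -/
def cumsum (p : ℕ → ℕ) (k : ℕ) : ℕ := ∑ j ∈ Finset.range k, p j

/-- The index of the block (among blocks `0, …, s`) containing position `i`,
for blocks of sizes `p 0, …, p (s-1)` followed by a final block. -/
def blkOf (p : ℕ → ℕ) (s i : ℕ) : ℕ :=
  ((Finset.range s).filter fun k => cumsum p (k + 1) ≤ i).card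

/-- The partition `μ = (d_0^{p_0}, …, d_{s-1}^{p_{s-1}}, 0^{p_s})` (0-indexed blocks),
as a function of the position `i ∈ {0, …, n-1}` where `n = cumsum p (s+1)`. -/
def muOf (s : ℕ) (d p : ℕ → ℕ) (i : ℕ) : ℕ :=
  if blkOf p s i < s then d (blkOf p s i) else 0

/-- The partition `μ ∖ c`, obtained from `μ` by replacing, for each `k`, the last `c k` of
the parts equal to `d k` by `d k - 1`. -/
def muMinus (s : ℕ) (d p c : ℕ → ℕ) (i : ℕ) : ℕ :=
  if blkOf p s i < s then
    (if p (blkOf p s i) - c (blkOf p s i) ≤ i - cumsum p (blkOf p s i) then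
      d (blkOf p s i) - 1 else d (blkOf p s i))
  else 0

/-- Indicator vector of a finite set `F`. -/
def eF (F : Finset ℕ) (j : ℕ) : ℕ := if j ∈ F then 1 else 0

end Blocks

/-! ## The simplicial complexes `Δ^{μ,c}(I)` and `Γ^{μ,c}(I)` -/

section Complexes

variable (K : Type) [Field K] (n : ℕ)

/-- The simplicial complex `Δ^{μ,c}(I) = {F ⊆ [s] : μ ∖ (c + e_F) ∈ P(I)}` (vertices are
`0, …, s-1`), for `μ = (d_0^{p_0}, …, d_{s-1}^{p_{s-1}}, 0^{p_s})` and `c ≤ p(μ)`. -/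
def DeltaCx (I : Ideal (MvPolynomial (Fin n) K)) (s : ℕ) (d p c : ℕ → ℕ) :
    Set (Finset ℕ) :=
  {F | F ⊆ Finset.range s ∧
    mon K n (fun i => muMinus s d p (fun j => c j + eF F j) i.val) ∈ I}

/-- The Alexander dual complex `Γ^{μ,c}(I) = {F ⊆ [s] : μ ∖ (c + e_{[s]∖F}) ∈ O(I)}`. -/
def GammaCx (I : Ideal (MvPolynomial (Fin n) K)) (s : ℕ) (d p c : ℕ → ℕ) :
    Set (Finset ℕ) :=
  {F | F ⊆ Finset.range s ∧
    mon K n (fun i => muMinus s d p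
      (fun j => c j + (if j < s ∧ j ∉ F then 1 else 0)) i.val) ∉ I}

/-- `γ_i^{μ,c}(I) = dim_K H̃_{i-1}(Δ^{μ,c}(I); K)`. -/
noncomputable def gammaDim (I : Ideal (MvPolynomial (Fin n) K)) (s : ℕ) (d p c : ℕ → ℕ)
    (i : ℕ) : ℕ :=
  rhd0 K (DeltaCx K n I s d p c) i

end Complexes

/-! ## Multigraded Tor via the Koszul complex

For a monomial ideal `I`, the multidegree-`a` strand of the Koszul complex `K_•(I)` is the
(shifted) reduced chain complex of the simplicial complex
`Δ_a^I = {F ⊆ [n] : a - e_F ≥ 0, x^{a - e_F} ∈ I}`, so that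
`dim_K Tor_i(I, K)_a = dim_K H̃_{i-1}(Δ_a^I; K)`, and similarly for `R/I` with the
condition `x^{a-e_F} ∉ I`. -/

section Tor

variable (K : Type) [Field K] (n : ℕ)

/-- The Koszul simplicial complex of the ideal `I` in multidegree `a`. -/
def KosI (I : Ideal (MvPolynomial (Fin n) K)) (a : Fin n → ℕ) : Set (Finset ℕ) :=
  {F | F ⊆ Finset.range n ∧ (∀ i : Fin n, (i : ℕ) ∈ F → 1 ≤ a i) ∧
    mon K n (fun i => a i - eF F i.val) ∈ I}

/-- The Koszul complex of `R/I` in multidegree `a`. -/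
def KosQ (I : Ideal (MvPolynomial (Fin n) K)) (a : Fin n → ℕ) : Set (Finset ℕ) :=
  {F | F ⊆ Finset.range n ∧ (∀ i : Fin n, (i : ℕ) ∈ F → 1 ≤ a i) ∧
    mon K n (fun i => a i - eF F i.val) ∉ I}

/-- `dim_K Tor_i(I, K)_a`, for a monomial ideal `I` and a multidegree `a ∈ ℤ^n`
(components with a negative coordinate vanish, so only `a ∈ ℕ^n` is needed). -/
noncomputable def torDim (I : Ideal (MvPolynomial (Fin n) K)) (i : ℕ) (a : Fin n → ℕ) : ℕ :=
  rhd0 K (KosI K n I a) i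

/-- `dim_K Tor_i(R/I, K)_a` for a monomial ideal `I`. -/
noncomputable def torQDim (I : Ideal (MvPolynomial (Fin n) K)) (i : ℕ) (a : Fin n → ℕ) : ℕ :=
  rhd0 K (KosQ K n I a) i

/-- `dim_K Tor_i(I, K)_{⟨μ⟩}`: the sum of `dim_K Tor_i(I, K)_a` over all rearrangements `a`
of the partition `μ`. -/
noncomputable def torDimSym (I : Ideal (MvPolynomial (Fin n) K)) (i : ℕ) (μ : Fin n → ℕ) : ℕ :=
  ∑ a ∈ Finset.image (fun σ : Equiv.Perm (Fin n) => μ ∘ σ) Finset.univ, torDim K n I i a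

/-- `dim_K Tor_i(R/I, K)_{⟨μ⟩}`. -/
noncomputable def torQDimSym (I : Ideal (MvPolynomial (Fin n) K)) (i : ℕ) (μ : Fin n → ℕ) : ℕ :=
  ∑ a ∈ Finset.image (fun σ : Equiv.Perm (Fin n) => μ ∘ σ) Finset.univ, torQDim K n I i a

end Tor

/-! ## Extended partitions in `P_n^∞` and the dual generators of an `S_n`-invariant
monomial ideal -/

section ExtendedPartitions

variable (K : Type) [Field K] (n : ℕ)

/-- `ℓ(μ)`: the number of entries of `μ ∈ P_n^∞` equal to `∞`. -/
def ellInf (μ : Fin n → ℕ∞) : ℕ := (Finset.univ.filter fun i => μ i = ⊤).card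

/-- The largest finite entry of `μ ∈ P_n^∞` (i.e. the first finite entry, `μ` being
weakly decreasing). -/
def topVal (μ : Fin n → ℕ∞) : ℕ := Finset.univ.sup fun i => (μ i).toNat

/-- `μ^+ ∈ P_n`: each `∞` entry of `μ` is replaced by (largest finite entry)` + 1`. -/
def plusOf (μ : Fin n → ℕ∞) (i : Fin n) : ℕ :=
  if μ i = ⊤ then topVal n μ + 1 else (μ i).toNat

/-- `μ̃ = μ^+ + (0^{ℓ(μ)}, 1^{n - ℓ(μ)}) ∈ P_n`. -/
def tildeOf (μ : Fin n → ℕ∞) (i : Fin n) : ℕ :=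
  if μ i = ⊤ then topVal n μ + 1 else (μ i).toNat + 1

/-- The ideal `Q_μ = ∩_{σ ∈ S_n} σ((x_k^{μ_k + 1}, …, x_n^{μ_n + 1}))`, where
`μ_k, …, μ_n` are the finite entries of `μ ∈ P_n^∞`. -/
noncomputable def Qgen (μ : Fin n → ℕ∞) : Ideal (MvPolynomial (Fin n) K) :=
  ⨅ σ : Equiv.Perm (Fin n),
    Ideal.map (MvPolynomial.rename σ).toRingHom
      (Ideal.span {g | ∃ i : Fin n, μ i ≠ ⊤ ∧ g = MvPolynomial.X i ^ ((μ i).toNat + 1)})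

/-- `Λ` is the (finite) set of dual generators of `I`, i.e. `I = ∩_{μ ∈ Λ} Q_μ` is the
irredundant presentation of `I` by ideals `Q_μ`. -/
def IsDualPresentation (I : Ideal (MvPolynomial (Fin n) K))
    (Λ : Finset (Fin n → ℕ∞)) : Prop :=
  (∀ μ ∈ Λ, Antitone μ) ∧ (I = ⨅ μ ∈ Λ, Qgen K n μ) ∧
    ∀ μ ∈ Λ, I ≠ ⨅ ρ ∈ Λ, ⨅ _ : ρ ≠ μ, Qgen K n ρ

/-- The partial order `≼` on dual generators: `μ ≼ ρ` iff `μ̃ ≤ ρ̃` (componentwise) and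
`ℓ(μ) - ℓ(ρ) ≤ |ρ̃| - |μ̃|`. -/
def preceq (μ ρ : Fin n → ℕ∞) : Prop :=
  (∀ i, tildeOf n μ i ≤ tildeOf n ρ i) ∧
    (∑ i, tildeOf n μ i) + ellInf n μ ≤ (∑ i, tildeOf n ρ i) + ellInf n ρ

/-- The extended partition `ρ = (∞^{p_0}, d_1^{p_1}, …, d_s^{p_s}) ∈ P_n^∞`
(so `n = p 0 + p 1 + ⋯ + p s`), as a function of the position `i ∈ {0, …, n-1}`. -/
def rhoOf (s : ℕ) (d p : ℕ → ℕ) (i : ℕ) : ℕ∞ :=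
  if blkOf p (s + 1) i = 0 then ⊤ else ((d (blkOf p (s + 1) i) : ℕ) : ℕ∞)

end ExtendedPartitions

/-! ## Minimal multigraded free resolutions and `Ext^i(R/I, R)` -/

section Resolution

variable (K : Type) [Field K] (n : ℕ)

/-- `f` is homogeneous of multidegree `δ ∈ ℤ^n` (the zero polynomial is homogeneous of
every degree). -/
def IsHomogZ (f : MvPolynomial (Fin n) K) (δ : Fin n → ℤ) : Prop :=
  ∀ m ∈ f.support, ∀ j, (m j : ℤ) = δ j

/-- The linear map given by a matrix `T` (with possibly infinitely many columns):
`(matApply T) v = fun b => ∑ a, T a b * v a`. -/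
noncomputable def matApply {α β : Type} [Fintype α]
    (T : α → β → MvPolynomial (Fin n) K) :
    (α → MvPolynomial (Fin n) K) →ₗ[MvPolynomial (Fin n) K]
      (β → MvPolynomial (Fin n) K) where
  toFun v := fun b => ∑ a, T a b * v a
  map_add' v w := by
    funext b
    simp [mul_add, Finset.sum_add_distrib]
  map_smul' r v := by
    funext b
    simp only [Pi.smul_apply, smul_eq_mul, RingHom.id_apply, Finset.mul_sum]
    exact Finset.sum_congr rfl fun a _ => by ring

variable (B : ℕ → Type) [∀ i, Fintype (B i)]
variable (Mtx : ∀ i, B (i + 1) → B i → MvPolynomial (Fin n) K)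

/-- The differential `d_i : F_{i+1} → F_i` of the free resolution, where `F_i` is free
on the basis `B i` and `d(e_b) = Σ_c (Mtx i b c) e_c`. -/
noncomputable def resD (i : ℕ) :
    (B (i + 1) → MvPolynomial (Fin n) K) →ₗ[MvPolynomial (Fin n) K]
      (B i → MvPolynomial (Fin n) K) :=
  matApply K n (Mtx i)

/-- The dual differential `∂^i : F_i^∨ → F_{i+1}^∨`, `(∂ z) b = Σ_c (Mtx i b c) * z c`
(in the dual bases `e_b^*`). -/
noncomputable def dualD (i : ℕ) :
    (B i → MvPolynomial (Fin n) K) →ₗ[MvPolynomial (Fin n) K]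
      (B (i + 1) → MvPolynomial (Fin n) K) :=
  matApply K n (fun (c : B i) (b : B (i + 1)) => Mtx i b c)

/-- The submodule of boundaries in `F_i^∨` (zero for `i = 0`). -/
noncomputable def dualBd :
    (i : ℕ) → Submodule (MvPolynomial (Fin n) K) (B i → MvPolynomial (Fin n) K)
  | 0 => ⊥
  | (i + 1) => LinearMap.range (dualD K n B Mtx i)

/-- The augmentation `F_0 → R`, `v ↦ Σ_b (aug b) * v b`. -/
noncomputable def augLin (aug : B 0 → MvPolynomial (Fin n) K) :
    (B 0 → MvPolynomial (Fin n) K) →ₗ[MvPolynomial (Fin n) K] MvPolynomial (Fin n) K :=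
  (LinearMap.proj (R := MvPolynomial (Fin n) K) (φ := fun _ : Unit => MvPolynomial (Fin n) K) ()) ∘ₗ
    matApply K n (fun b (_ : Unit) => aug b)

/-- The maximal graded ideal `m = (x_1, …, x_n)`. -/
def mIdeal : Ideal (MvPolynomial (Fin n) K) :=
  Ideal.span (Set.range MvPolynomial.X)

/-- The data `(B, dg, Mtx, aug)` is a minimal `ℤ^n`-graded free resolution of `R/I`:
each `F_i` is free with finite basis `B i`, with `deg e_b = dg i b`; the differentials
are homogeneous, minimal (entries in `m`), and the complex
`⋯ → F_1 → F_0 → R/I → 0` is exact. -/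
def IsMinimalFreeResolution (I : Ideal (MvPolynomial (Fin n) K))
    (dg : ∀ i, B i → Fin n → ℤ) (aug : B 0 → MvPolynomial (Fin n) K) : Prop :=
  (∀ i b c, IsHomogZ K n (Mtx i b c) (fun j => dg (i + 1) b j - dg i c j)) ∧
  (∀ b, IsHomogZ K n (aug b) (fun j => dg 0 b j)) ∧
  (∀ i b c, MvPolynomial.coeff 0 (Mtx i b c) = 0) ∧
  (∀ f : MvPolynomial (Fin n) K, ∃ v, f - augLin K n B aug v ∈ I) ∧
  (∀ v, augLin K n B aug v ∈ I ↔ v ∈ LinearMap.range (resD K n B Mtx 0)) ∧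
  (∀ i, LinearMap.ker (resD K n B Mtx i) = LinearMap.range (resD K n B Mtx (i + 1)))

/-- `Ext^i(R/I, R)_{-a} ≠ 0` (for `a ∈ ℤ^n`), computed from the dual of the resolution:
there is a homogeneous cycle of multidegree `-a` in `F_i^∨` which is not a boundary. -/
def ExtNZ (dg : ∀ i, B i → Fin n → ℤ) (i : ℕ) (a : Fin n → ℤ) : Prop :=
  ∃ z : B i → MvPolynomial (Fin n) K,
    (∀ b, IsHomogZ K n (z b) (fun j => dg i b j - a j)) ∧
    dualD K n B Mtx i z = 0 ∧ z ∉ dualBd K n B Mtx i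

/-- `Ext^i(R/I, R)_{⟨-μ⟩} ≠ 0` for a partition `μ ∈ P_n`. -/
def ExtSymNZ (dg : ∀ i, B i → Fin n → ℤ) (i : ℕ) (μ : Fin n → ℕ) : Prop :=
  ∃ a : Fin n → ℕ, (∃ σ : Equiv.Perm (Fin n), a = μ ∘ σ) ∧
    ExtNZ K n B Mtx dg i (fun t => (a t : ℤ))

/-- `(i, λ) ∈ [n] × P_n` is an Ext-extremal pair: `Ext^i(R/I,R)_{⟨-λ⟩} ≠ 0` and
`Ext^j(R/I,R)_{⟨-μ⟩} = 0` for all `j ≥ i` and partitions `μ ≩ λ` with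
`|μ| - j ≥ |λ| - i`. -/
def IsExtExtremalPair (dg : ∀ i, B i → Fin n → ℤ) (i : ℕ) (l : Fin n → ℕ) : Prop :=
  1 ≤ i ∧ i ≤ n ∧ Antitone l ∧ ExtSymNZ K n B Mtx dg i l ∧
    ∀ (j : ℕ) (μ : Fin n → ℕ), i ≤ j → Antitone μ → (∀ t, l t ≤ μ t) → l ≠ μ →
      ((∑ t, (l t : ℤ)) - i ≤ (∑ t, (μ t : ℤ)) - j) → ¬ ExtSymNZ K n B Mtx dg j μ

/-- The space of homogeneous cycles of multidegree `-a` in `F_i^∨`, as a `K`-subspace. -/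
noncomputable def extZ (dg : ∀ i, B i → Fin n → ℤ) (i : ℕ) (a : Fin n → ℤ) :
    Submodule K (B i → MvPolynomial (Fin n) K) where
  carrier := {z | (∀ b, IsHomogZ K n (z b) (fun j => dg i b j - a j)) ∧
    dualD K n B Mtx i z = 0}
  add_mem' := by
    rintro z w ⟨hz1, hz2⟩ ⟨hw1, hw2⟩
    refine ⟨fun b m hm j => ?_, by rw [map_add, hz2, hw2, add_zero]⟩
    have hsub : m ∈ (z b).support ∪ (w b).support :=
      MvPolynomial.support_add (by simpa using hm)
    rcases Finset.mem_union.mp hsub with h | h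
    · exact hz1 b m h j
    · exact hw1 b m h j
  zero_mem' := ⟨fun b m hm j => by simp at hm, map_zero _⟩
  smul_mem' := by
    rintro kk z ⟨hz1, hz2⟩
    constructor
    · intro b m hm j
      apply hz1 b m _ j
      have hmem : m ∈ (kk • z b).support := by simpa using hm
      exact MvPolynomial.support_smul hmem
    · rw [LinearMap.map_smul_of_tower, hz2, smul_zero]

/-- `dim_K Ext^i(R/I, R)_{-a}`: homogeneous cycles modulo homogeneous boundaries. -/
noncomputable def extDim (dg : ∀ i, B i → Fin n → ℤ) (i : ℕ) (a : Fin n → ℤ) : ℕ :=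
  Module.finrank K (extZ K n B Mtx dg i a) -
    Module.finrank K
      ((dualBd K n B Mtx i).restrictScalars K ⊓ extZ K n B Mtx dg i a : Submodule K _)

end Resolution

/-- `(i, λ) ∈ [n] × P_n` is an extremal pair in the Betti table of `R/I`:
`Tor_i(R/I, k)_{⟨λ⟩} ≠ 0`, and `Tor_j(R/I, k)_{⟨μ⟩} = 0` for all `j ≥ i` and all
partitions `μ ≩ λ` with `|μ| - j ≥ |λ| - i`. -/
def IsExtremalPair (K : Type) [Field K] (n : ℕ) (I : Ideal (MvPolynomial (Fin n) K))
    (i : ℕ) (l : Fin n → ℕ) : Prop :=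
  1 ≤ i ∧ i ≤ n ∧ Antitone l ∧ torQDimSym K n I i l ≠ 0 ∧
    ∀ (j : ℕ) (μ : Fin n → ℕ), i ≤ j → Antitone μ → (∀ t, l t ≤ μ t) → l ≠ μ →
      ((∑ t, (l t : ℤ)) - i ≤ (∑ t, (μ t : ℤ)) - j) → torQDimSym K n I j μ = 0

section DoubleComplex

open Module LinearMap

variable {K : Type*} [Field K]

theorem finrank_map_add_finrank_inf_ker {V W : Type*} [AddCommGroup V] [Module K V]
    [FiniteDimensional K V] [AddCommGroup W] [Module K W] (f : V →ₗ[K] W) (S : Submodule K V) :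
    finrank K (S.map f) + finrank K (S ⊓ ker f : Submodule K V) = finrank K S := by
  have h := finrank_range_add_finrank_ker (f.domRestrict S)
  rw [range_domRestrict, ker_domRestrict] at h
  rw [← h, ← Submodule.finrank_map_subtype_eq S (Submodule.comap _ _), Submodule.map_comap_subtype]

/-- Dimension shifting along one step of a commutative ladder. -/
theorem finrank_ladder {C₂ C₁ C₀ E₂ E₁ E₀ : Type*}
    [AddCommGroup C₂] [Module K C₂] [AddCommGroup C₁] [Module K C₁] [FiniteDimensional K C₁]
    [AddCommGroup C₀] [Module K C₀] [AddCommGroup E₂] [Module K E₂]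
    [AddCommGroup E₁] [Module K E₁] [AddCommGroup E₀] [Module K E₀]
    (δ₂ : C₂ →ₗ[K] C₁) (δ₁ : C₁ →ₗ[K] C₀) (ε₂ : E₂ →ₗ[K] E₁) (ε₁ : E₁ →ₗ[K] E₀)
    (d₂ : C₂ →ₗ[K] E₂) (d₁ : C₁ →ₗ[K] E₁) (d₀ : C₀ →ₗ[K] E₀)
    (h₁ : d₁ ∘ₗ δ₂ = ε₂ ∘ₗ d₂) (h₀ : d₀ ∘ₗ δ₁ = ε₁ ∘ₗ d₁) (hex : ker δ₁ = range δ₂) :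
    finrank K (range d₁ ⊓ ker ε₁ : Submodule K E₁) + finrank K ((ker d₁).map δ₁) =
      finrank K (range δ₁ ⊓ ker d₀ : Submodule K C₀) + finrank K ((range d₂).map ε₂) := by
  have a₁ := finrank_map_add_finrank_inf_ker d₁ (ker (ε₁ ∘ₗ d₁))
  have a₂ := finrank_map_add_finrank_inf_ker δ₁ (ker (d₀ ∘ₗ δ₁))
  have a₃ := finrank_map_add_finrank_inf_ker d₁ (ker δ₁)
  have a₄ := finrank_map_add_finrank_inf_ker δ₁ (ker d₁)
  rw [inf_eq_right.2 (ker_le_ker_comp _ _), ker_comp, Submodule.map_comap_eq] at a₁ a₂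
  rw [← ker_comp, ← h₀, ker_comp] at a₁
  rw [inf_comm (ker d₁)] at a₄
  have e : (ker δ₁).map d₁ = (range d₂).map ε₂ := by
    rw [hex, ← range_comp, ← range_comp, h₁]
  rw [e] at a₃
  omega

variable {C : ℕ → ℕ → Type*} [∀ p q, AddCommGroup (C p q)] [∀ p q, Module K (C p q)]

/-- The cycles, for the vertical differential `δ`, in the image of the horizontal one. -/
def imageCycles (δ : ∀ p q, C (p + 1) q →ₗ[K] C p q) (d : ∀ p q, C p (q + 1) →ₗ[K] C p q) :
    ∀ p q, Submodule K (C p q)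
  | 0, q => range (d 0 q)
  | p + 1, q => range (d (p + 1) q) ⊓ ker (δ p q)

theorem finrank_imageCycles [∀ p q, FiniteDimensional K (C p q)]
    (δ : ∀ p q, C (p + 1) q →ₗ[K] C p q) (d : ∀ p q, C p (q + 1) →ₗ[K] C p q)
    (hcomm : ∀ p q, d p q ∘ₗ δ p (q + 1) = δ p q ∘ₗ d (p + 1) q)
    (hrow : ∀ p q, ker (d p q) = range (d p (q + 1)))
    (hcol : ∀ p q, ker (δ p (q + 1)) = range (δ (p + 1) (q + 1)))
    (hmin : ∀ q, range (d 0 (q + 1)) ≤ range (δ 0 (q + 1))) (p : ℕ) : ∀ q r, r = q + p →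
    finrank K (imageCycles δ d p q) + finrank K ((range (d (0 + 1) r)).map (δ 0 r)) =
      finrank K (imageCycles δ d 0 r) + finrank K ((range (d (p + 1) q)).map (δ p q)) := by
  induction p with
  | zero => rintro q r rfl; rfl
  | succ p ih =>
    intro q r hr
    have h := ih (q + 1) r (by omega)
    have h' := finrank_ladder (δ (p + 1) (q + 1)) (δ p (q + 1)) (δ (p + 1) q) (δ p q)
      (d (p + 1 + 1) q) (d (p + 1) q) (d p q) (hcomm _ _) (hcomm _ _) (hcol _ _)
    have e : imageCycles δ d p (q + 1) = range (δ p (q + 1)) ⊓ ker (d p q) := by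
      rw [hrow, inf_comm]
      cases p with
      | zero => exact (inf_eq_left.2 (hmin q)).symm
      | succ p => rw [← hcol]; rfl
    rw [← e, hrow] at h'
    change finrank K (range (d (p + 1) q) ⊓ ker (δ p q) : Submodule K _) + _ = _
    omega

/-- Balancing: the homology of the zeroth column of a first quadrant double complex with exact
rows is computed by the bottom row, modulo the columns, if the latter are exact and the
horizontal differentials vanish on the quotient. -/
theorem finrank_homology_zeroth_column [∀ p q, FiniteDimensional K (C p q)]
    (δ : ∀ p q, C (p + 1) q →ₗ[K] C p q) (d : ∀ p q, C p (q + 1) →ₗ[K] C p q)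
    (hcomm : ∀ p q, d p q ∘ₗ δ p (q + 1) = δ p q ∘ₗ d (p + 1) q)
    (hsurj : ∀ p, range (d p 0) = ⊤)
    (hrow : ∀ p q, ker (d p q) = range (d p (q + 1)))
    (hcol : ∀ p q, ker (δ p (q + 1)) = range (δ (p + 1) (q + 1)))
    (hmin : ∀ q, range (d 0 (q + 1)) ≤ range (δ 0 (q + 1))) (p : ℕ) :
    finrank K (imageCycles δ d p 0) + finrank K (range (δ 0 (p + 1))) =
      finrank K (C 0 (p + 1)) + finrank K (range (δ p 0)) := by
  have h := finrank_imageCycles δ d hcomm hrow hcol hmin p 0 p (by omega)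
  rw [hsurj, Submodule.map_top] at h
  have a₁ := finrank_range_add_finrank_ker (d 0 p)
  have a₂ := finrank_map_add_finrank_inf_ker (d 0 p) (range (δ 0 (p + 1)))
  rw [hrow] at a₁
  rw [hrow, inf_eq_right.2 (hmin p), ← range_comp, hcomm, range_comp] at a₂
  change _ = finrank K (range (d 0 p)) + _ at h
  omega

theorem range_le_ker_zeroth_column
    (δ : ∀ p q, C (p + 1) q →ₗ[K] C p q) (d : ∀ p q, C p (q + 1) →ₗ[K] C p q)
    (hcomm : ∀ p q, d p q ∘ₗ δ p (q + 1) = δ p q ∘ₗ d (p + 1) q)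
    (hsurj : ∀ p, range (d p 0) = ⊤)
    (hcol : ∀ p q, ker (δ p (q + 1)) = range (δ (p + 1) (q + 1))) (p : ℕ) :
    range (δ (p + 1) 0) ≤ ker (δ p 0) := by
  rintro _ ⟨x, rfl⟩
  obtain ⟨y, rfl⟩ := range_eq_top.1 (hsurj _) x
  have e : δ p 1 (δ (p + 1) 1 y) = 0 := (hcol p 0).ge ⟨y, rfl⟩
  rw [mem_ker, ← comp_apply (δ (p + 1) 0), ← hcomm, comp_apply, ← comp_apply (δ p 0), ← hcomm,
    comp_apply, e, map_zero]

end DoubleComplex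

section LabelledChains

open Module LinearMap

variable {K : Type} [Field K] {α β : Type}

/-- The sign of the vertex `v` in the boundary of the face `F`. -/
def faceSign (K : Type) [Field K] (F : Finset ℕ) (v : ℕ) : K :=
  (-1 : K) ^ (F.filter fun u => u ≤ v).card

/-- A face with `j` elements, as an index of the chain group. -/
def ChainIdx.ofMem {S : Set (α × Finset ℕ)} {j : ℕ} (x : α × Finset ℕ)
    (h : x ∈ S ∧ x.2.card = j) : ChainIdx S j := ⟨x, h⟩

/-- The labelled face underlying an index of the chain group. -/
def ChainIdx.toProd {S : Set (α × Finset ℕ)} {j : ℕ} (x : ChainIdx S j) : α × Finset ℕ := x.1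

theorem ChainIdx.toProd_mem {S : Set (α × Finset ℕ)} {j : ℕ} (x : ChainIdx S j) :
    x.toProd ∈ S ∧ x.toProd.2.card = j := x.2

theorem ChainIdx.toProd_injective {S : Set (α × Finset ℕ)} {j : ℕ} :
    Function.Injective (ChainIdx.toProd : ChainIdx S j → _) := Subtype.val_injective

theorem ChainIdx.toProd_ofMem {S : Set (α × Finset ℕ)} {j : ℕ} (x : α × Finset ℕ)
    (h : x ∈ S ∧ x.2.card = j) : (ChainIdx.ofMem x h).toProd = x := rfl

/-- The basis chain at `x`, or zero if `x` is not a face with `j` elements. -/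
def chainSingle (K : Type) [Field K] (S : Set (α × Finset ℕ)) (j : ℕ) (x : α × Finset ℕ) :
    ChainIdx S j →₀ K :=
  if h : x ∈ S ∧ x.2.card = j then Finsupp.single (ChainIdx.ofMem x h) 1 else 0

theorem chainSingle_of_mem {S : Set (α × Finset ℕ)} {j : ℕ} {x : α × Finset ℕ}
    (h : x ∈ S ∧ x.2.card = j) :
    chainSingle K S j x = Finsupp.single (ChainIdx.ofMem x h) 1 := dif_pos h

theorem chainSingle_of_notMem {S : Set (α × Finset ℕ)} {j : ℕ} {x : α × Finset ℕ}
    (h : x ∉ S) : chainSingle K S j x = 0 := dif_neg fun h' => h h'.1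

theorem chainSingle_toProd {S : Set (α × Finset ℕ)} {j : ℕ} (x : ChainIdx S j) :
    chainSingle K S j x.toProd = Finsupp.single x 1 := chainSingle_of_mem x.toProd_mem

theorem chainSingle_apply {S : Set (α × Finset ℕ)} {j : ℕ} (x : α × Finset ℕ)
    (y : ChainIdx S j) : chainSingle K S j x y = if x = y.toProd then 1 else 0 := by
  split_ifs with h
  · rw [h, chainSingle_toProd, Finsupp.single_eq_same]
  · unfold chainSingle
    split_ifs with h'
    · exact Finsupp.single_eq_of_ne fun e => h (by rw [e, ChainIdx.toProd_ofMem])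
    · rfl

theorem chain_hom_ext {S : Set (α × Finset ℕ)} {j : ℕ} {V : Type*} [AddCommGroup V]
    [Module K V] {f g : (ChainIdx S j →₀ K) →ₗ[K] V}
    (h : ∀ b F, (b, F) ∈ S → F.card = j →
      f (chainSingle K S j (b, F)) = g (chainSingle K S j (b, F))) : f = g := by
  refine Finsupp.lhom_ext' fun x => LinearMap.ext_ring ?_
  have := h x.toProd.1 x.toProd.2 x.toProd_mem.1 x.toProd_mem.2
  rwa [chainSingle_toProd] at this

theorem bd_chainSingle {S : Set (α × Finset ℕ)} {j : ℕ} {b : α} {F : Finset ℕ}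
    (hS : (b, F) ∈ S) (hF : F.card = j + 1) :
    bd K S j (chainSingle K S (j + 1) (b, F)) =
      ∑ v ∈ F, faceSign K F v • chainSingle K S j (b, F.erase v) := by
  rw [chainSingle_of_mem ⟨hS, hF⟩, bd, Finsupp.linearCombination_single, one_smul, bdElt]
  refine Finset.sum_congr rfl fun v _ => ?_
  by_cases h : (b, F.erase v) ∈ S ∧ (F.erase v).card = j
  · rw [chainSingle_of_mem h]
    exact dif_pos h
  · rw [chainSingle, dif_neg h, smul_zero]
    exact dif_neg h

/-- The map of chains induced by a matrix on labels. -/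
def labelMap (S : Set (α × Finset ℕ)) (T : Set (β × Finset ℕ)) [Fintype β] (m : α → β → K)
    (j : ℕ) : (ChainIdx S j →₀ K) →ₗ[K] (ChainIdx T j →₀ K) :=
  Finsupp.linearCombination K fun x =>
    ∑ c, m x.toProd.1 c • chainSingle K T j (c, x.toProd.2)

theorem labelMap_chainSingle {S : Set (α × Finset ℕ)} {T : Set (β × Finset ℕ)} [Fintype β]
    (m : α → β → K) {j : ℕ} {b : α} {F : Finset ℕ} (hS : (b, F) ∈ S) (hF : F.card = j) :
    labelMap S T m j (chainSingle K S j (b, F)) = ∑ c, m b c • chainSingle K T j (c, F) := by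
  rw [chainSingle_of_mem ⟨hS, hF⟩, labelMap, Finsupp.linearCombination_single, one_smul]
  rfl

theorem labelMap_comp_bd {S : Set (α × Finset ℕ)} {T : Set (β × Finset ℕ)} [Fintype β]
    (m : α → β → K) (hS : ∀ b F v, (b, F) ∈ S → (b, F.erase v) ∈ S)
    (hT : ∀ b c F v, (b, F) ∈ S → m b c ≠ 0 → v ∈ F → (c, F.erase v) ∈ T → (c, F) ∈ T) (j : ℕ) :
    labelMap S T m j ∘ₗ bd K S j = bd K T j ∘ₗ labelMap S T m (j + 1) := by
  refine chain_hom_ext fun b F hbF hF => ?_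
  rw [comp_apply, comp_apply, bd_chainSingle hbF hF, labelMap_chainSingle m hbF hF, map_sum,
    map_sum]
  have h₁ : ∀ v ∈ F, labelMap S T m j (faceSign K F v • chainSingle K S j (b, F.erase v)) =
      ∑ c, (m b c * faceSign K F v) • chainSingle K T j (c, F.erase v) := fun v hv => by
    rw [map_smul, labelMap_chainSingle m (hS b F v hbF) (by
      rw [Finset.card_erase_of_mem hv, hF]; rfl), Finset.smul_sum]
    exact Finset.sum_congr rfl fun c _ => by rw [smul_smul, mul_comm]
  rw [Finset.sum_congr rfl h₁, Finset.sum_comm]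
  refine Finset.sum_congr rfl fun c _ => ?_
  rw [map_smul]
  by_cases hm : m b c = 0
  · simp [hm]
  by_cases hc : (c, F) ∈ T
  · rw [bd_chainSingle hc hF, Finset.smul_sum]
    exact Finset.sum_congr rfl fun v _ => by rw [smul_smul]
  · rw [chainSingle_of_notMem hc, map_zero, smul_zero]
    refine Finset.sum_eq_zero fun v hv => ?_
    rw [chainSingle_of_notMem fun h => hc (hT b c F v hbF hm hv h), smul_zero]

/-- The coefficient of a chain at `x`, zero if `x` is not a face with `j` elements. -/
def chainCoeff {S : Set (α × Finset ℕ)} {j : ℕ} (x : α × Finset ℕ) :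
    (ChainIdx S j →₀ K) →ₗ[K] K :=
  if h : x ∈ S ∧ x.2.card = j then Finsupp.lapply (ChainIdx.ofMem x h) else 0

theorem chainCoeff_toProd {S : Set (α × Finset ℕ)} {j : ℕ} (x : ChainIdx S j)
    (z : ChainIdx S j →₀ K) : chainCoeff x.toProd z = z x := by
  rw [chainCoeff, dif_pos x.toProd_mem]; rfl

theorem chainCoeff_chainSingle {S : Set (α × Finset ℕ)} {j : ℕ} (x y : α × Finset ℕ)
    (hy : y ∈ S ∧ y.2.card = j) :
    chainCoeff x (chainSingle K S j y) = if y = x then 1 else 0 := by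
  unfold chainCoeff
  split_ifs with h h' h'
  · rw [Finsupp.lapply_apply, chainSingle_apply, ChainIdx.toProd_ofMem, if_pos h']
  · rw [Finsupp.lapply_apply, chainSingle_apply, ChainIdx.toProd_ofMem, if_neg h']
  · exact absurd (h' ▸ hy) h
  · rfl

theorem chainCoeff_of_notMem {S : Set (α × Finset ℕ)} {j : ℕ} {x : α × Finset ℕ}
    (h : x ∉ S) (z : ChainIdx S j →₀ K) : chainCoeff x z = 0 := by
  rw [chainCoeff, dif_neg fun h' => h h'.1]; rfl

theorem chainCoeff_labelMap {S : Set (α × Finset ℕ)} {T : Set (β × Finset ℕ)} [Fintype α]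
    [Fintype β] (m : α → β → K) {j : ℕ} (z : ChainIdx S j →₀ K) {c : β} {F : Finset ℕ}
    (hT : (c, F) ∈ T) :
    chainCoeff (c, F) (labelMap S T m j z) = ∑ b, chainCoeff (b, F) z * m b c := by
  have key : chainCoeff (c, F) ∘ₗ labelMap S T m j =
      ∑ b, m b c • (chainCoeff (b, F) : (ChainIdx S j →₀ K) →ₗ[K] K) := by
    refine chain_hom_ext fun b G hb hG => ?_
    rw [comp_apply, labelMap_chainSingle m hb hG, map_sum, LinearMap.sum_apply,
      Finset.sum_eq_single c, Finset.sum_eq_single b]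
    · rw [map_smul, LinearMap.smul_apply, chainCoeff_chainSingle _ _ ⟨hb, hG⟩]
      by_cases h : G = F
      · subst h
        rw [chainCoeff_chainSingle _ _ ⟨hT, hG⟩, if_pos rfl, if_pos rfl]
      · rw [if_neg fun e => h (congrArg Prod.snd e)]
        unfold chainSingle
        split_ifs with h'
        · rw [← chainSingle_of_mem h', chainCoeff_chainSingle _ _ h',
            if_neg fun e => h (congrArg Prod.snd e)]
        · rw [map_zero]
    · intro b' _ hb'
      rw [LinearMap.smul_apply, chainCoeff_chainSingle _ _ ⟨hb, hG⟩,
        if_neg fun e => hb' (congrArg Prod.fst e).symm, smul_zero]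
    · simp
    · intro c' _ hc'
      rw [map_smul]
      unfold chainSingle
      split_ifs with h'
      · rw [← chainSingle_of_mem h', chainCoeff_chainSingle _ _ h',
          if_neg fun e => hc' (congrArg Prod.fst e), smul_zero]
      · rw [map_zero, smul_zero]
    · simp
  rw [← comp_apply, key, LinearMap.sum_apply]
  exact Finset.sum_congr rfl fun b _ => by rw [LinearMap.smul_apply, smul_eq_mul, mul_comm]

/-- The chain with prescribed coefficients. -/
def chainOfCoeff {S : Set (α × Finset ℕ)} {j : ℕ} [Finite (ChainIdx S j)]
    (w : α × Finset ℕ → K) : ChainIdx S j →₀ K :=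
  Finsupp.equivFunOnFinite.symm fun x => w x.toProd

theorem chainCoeff_chainOfCoeff {S : Set (α × Finset ℕ)} {j : ℕ} [Finite (ChainIdx S j)]
    (w : α × Finset ℕ → K) {x : α × Finset ℕ} (hx : x ∈ S ∧ x.2.card = j) :
    chainCoeff x (chainOfCoeff w : ChainIdx S j →₀ K) = w x := by
  rw [chainCoeff, dif_pos hx]; rfl

theorem chain_ext {S : Set (α × Finset ℕ)} {j : ℕ} {z z' : ChainIdx S j →₀ K}
    (h : ∀ b F, (b, F) ∈ S → F.card = j → chainCoeff (b, F) z = chainCoeff (b, F) z') :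
    z = z' := by
  refine Finsupp.ext fun x => ?_
  rw [← chainCoeff_toProd, ← chainCoeff_toProd]
  exact h _ _ x.toProd_mem.1 x.toProd_mem.2

end LabelledChains

section Exactness

open Module LinearMap

variable {K : Type} [Field K] {α β γ : Type}

theorem labelMap_ker_eq_range {U : Set (γ × Finset ℕ)} {S : Set (α × Finset ℕ)}
    {T : Set (β × Finset ℕ)} [Fintype α] [Fintype β] [Fintype γ] {j : ℕ} [Finite (ChainIdx U j)]
    (m : α → β → K) (m' : γ → α → K)
    (h : ∀ F, ∀ v : α → K, (∀ b, v b ≠ 0 → (b, F) ∈ S) →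
      ((∀ c, (c, F) ∈ T → ∑ b, v b * m b c = 0) ↔
        ∃ w : γ → K, (∀ g, w g ≠ 0 → (g, F) ∈ U) ∧
          ∀ b, (b, F) ∈ S → ∑ g, w g * m' g b = v b)) :
    ker (labelMap S T m j) = range (labelMap U S m' j) := by
  have hsupp : ∀ (z : ChainIdx S j →₀ K) F b, chainCoeff (b, F) z ≠ 0 → (b, F) ∈ S :=
    fun z F b hb => by_contra fun hS => hb (chainCoeff_of_notMem hS z)
  have hsupp' : ∀ (z : ChainIdx U j →₀ K) F b, chainCoeff (b, F) z ≠ 0 → (b, F) ∈ U :=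
    fun z F b hb => by_contra fun hS => hb (chainCoeff_of_notMem hS z)
  ext z
  constructor
  · intro hz
    have h₁ : ∀ F, ∃ w : γ → K, (∀ g, w g ≠ 0 → (g, F) ∈ U) ∧
        ∀ b, (b, F) ∈ S → ∑ g, w g * m' g b = chainCoeff (b, F) z := fun F => by
      refine (h F (fun b => chainCoeff (b, F) z) (hsupp z F)).1 fun c hc => ?_
      rw [← chainCoeff_labelMap m z hc, mem_ker.1 hz, map_zero]
    choose w hw hw' using h₁
    refine ⟨chainOfCoeff fun x => w x.2 x.1, chain_ext fun b F hb hF => ?_⟩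
    rw [chainCoeff_labelMap m' _ hb, ← hw' F b hb]
    refine Finset.sum_congr rfl fun g _ => ?_
    by_cases hg : (g, F) ∈ U
    · rw [chainCoeff_chainOfCoeff _ ⟨hg, hF⟩]
    · rw [chainCoeff_of_notMem hg, by_contra fun h' => hg (hw F g h')]
  · rintro ⟨y, rfl⟩
    refine mem_ker.2 (chain_ext fun c F hc hF => ?_)
    rw [chainCoeff_labelMap m _ hc, map_zero]
    exact (h F _ (hsupp _ F)).2
      ⟨_, hsupp' y F, fun b hb => (chainCoeff_labelMap m' y hb).symm⟩ c hc

theorem labelMap_range_eq_top {S : Set (α × Finset ℕ)}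
    {T : Set (β × Finset ℕ)} [Fintype α] [Fintype β] {j : ℕ} [Finite (ChainIdx S j)]
    (m : α → β → K)
    (h : ∀ F, ∀ v : β → K, ∃ w : α → K, (∀ b, w b ≠ 0 → (b, F) ∈ S) ∧
      ∀ c, (c, F) ∈ T → ∑ b, w b * m b c = v c) :
    range (labelMap S T m j) = ⊤ := by
  refine range_eq_top.2 fun z => ?_
  choose w hw hw' using fun F => h F fun c => chainCoeff (c, F) z
  refine ⟨chainOfCoeff fun x => w x.2 x.1, chain_ext fun c F hc hF => ?_⟩
  rw [chainCoeff_labelMap m _ hc, ← hw' F c hc]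
  refine Finset.sum_congr rfl fun b _ => ?_
  by_cases hb : (b, F) ∈ S
  · rw [chainCoeff_chainOfCoeff _ ⟨hb, hF⟩]
  · rw [chainCoeff_of_notMem hb, by_contra fun h' => hb (hw F b h')]

theorem faceSign_erase {F : Finset ℕ} {v w : ℕ} (hv : v ∈ F) :
    faceSign K (F.erase v) w = if v ≤ w then -faceSign K F w else faceSign K F w := by
  unfold faceSign
  rw [Finset.filter_erase]
  split_ifs with h
  · have hm : v ∈ F.filter fun u => u ≤ w := Finset.mem_filter.2 ⟨hv, h⟩
    rw [← Finset.card_erase_add_one hm, pow_succ]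
    ring
  · rw [Finset.erase_eq_of_notMem (s := F.filter fun u => u ≤ w) (a := v)
      fun h' => h (Finset.mem_filter.1 h').2]

theorem bd_comp_bd {S : Set (α × Finset ℕ)} (hS : ∀ b F v, (b, F) ∈ S → (b, F.erase v) ∈ S)
    (j : ℕ) : bd K S j ∘ₗ bd K S (j + 1) = 0 := by
  refine chain_hom_ext fun b F hb hF => ?_
  have h₁ : ∀ v ∈ F, bd K S j (faceSign K F v • chainSingle K S (j + 1) (b, F.erase v)) =
      ∑ w ∈ F.erase v, (faceSign K F v * faceSign K (F.erase v) w) •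
        chainSingle K S j (b, (F.erase v).erase w) := fun v hv => by
    rw [map_smul, bd_chainSingle (hS b F v hb) (by
      rw [Finset.card_erase_of_mem hv, hF]; rfl), Finset.smul_sum]
    exact Finset.sum_congr rfl fun w _ => by rw [smul_smul]
  rw [comp_apply, bd_chainSingle hb hF, map_sum, Finset.sum_congr rfl h₁, Finset.sum_sigma',
    LinearMap.zero_apply]
  refine Finset.sum_involution (fun x _ => ⟨x.2, x.1⟩) ?_ ?_ ?_ ?_
  · rintro ⟨v, w⟩ hx
    simp only [Finset.mem_sigma, Finset.mem_erase] at hx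
    obtain ⟨hv, hwv, hw⟩ := hx
    simp only
    rw [Finset.erase_right_comm, ← add_smul, faceSign_erase hv, faceSign_erase hw]
    rcases lt_or_gt_of_ne hwv with h | h
    · rw [if_neg (by omega), if_pos h.le]
      convert zero_smul K _
      ring
    · rw [if_pos h.le, if_neg (by omega)]
      convert zero_smul K _
      ring
  · rintro ⟨v, w⟩ hx _ h
    simp only [Finset.mem_sigma, Finset.mem_erase] at hx
    exact hx.2.1 (congrArg Sigma.fst h)
  · rintro ⟨v, w⟩ hx
    simp only [Finset.mem_sigma, Finset.mem_erase] at hx ⊢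
    exact ⟨hx.2.2, hx.2.1.symm, hx.1⟩
  · rintro ⟨v, w⟩ _
    rfl

/-- A disjoint union of full simplices, one on the vertex set `A b` for each label `b ∈ L`. -/
def simplexFaces (L : Set α) (A : α → Finset ℕ) : Set (α × Finset ℕ) :=
  {x | x.1 ∈ L ∧ x.2 ⊆ A x.1}

theorem simplexFaces_erase {L : Set α} {A : α → Finset ℕ} (b : α) (F : Finset ℕ) (v : ℕ)
    (h : (b, F) ∈ simplexFaces L A) : (b, F.erase v) ∈ simplexFaces L A :=
  ⟨h.1, (Finset.erase_subset _ _).trans h.2⟩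

theorem finite_chainIdx [Finite α] {S : Set (α × Finset ℕ)} (A : α → Finset ℕ)
    (h : ∀ b F, (b, F) ∈ S → F ⊆ A b) (j : ℕ) : Finite (ChainIdx S j) := by
  refine Finite.of_injective (β := Σ b : α, {F // F ∈ (A b).powerset})
    (fun x => ⟨x.toProd.1, x.toProd.2, Finset.mem_powerset.2 (h _ _ x.toProd_mem.1)⟩) ?_
  intro x y e
  refine ChainIdx.toProd_injective (Prod.ext (congrArg Sigma.fst e) ?_)
  exact congrArg (fun s : Σ b : α, {F // F ∈ (A b).powerset} => s.2.1) e

theorem simplexFaces_ker_eq_range (L : Set α) (A : α → Finset ℕ) (j : ℕ) :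
    ker (bd K (simplexFaces L A) j) = range (bd K (simplexFaces L A) (j + 1)) := by
  set S := simplexFaces L A
  refine le_antisymm ?_ (range_le_ker_iff.2 (bd_comp_bd simplexFaces_erase j))
  let t : α → ℕ := fun b => if h : (A b).Nonempty then (A b).min' h else 0
  have ht : ∀ b, ∀ v ∈ A b, t b ∈ A b ∧ t b ≤ v := fun b v hv => by
    have hne : (A b).Nonempty := ⟨v, hv⟩
    simp only [t, dif_pos hne]
    exact ⟨Finset.min'_mem _ _, Finset.min'_le _ _ hv⟩
  let H : ∀ i, (ChainIdx S i →₀ K) →ₗ[K] (ChainIdx S (i + 1) →₀ K) := fun i =>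
    Finsupp.linearCombination K fun x => if t x.toProd.1 ∈ x.toProd.2 then 0 else
      -chainSingle K S (i + 1) (x.toProd.1, insert (t x.toProd.1) x.toProd.2)
  have hH : ∀ i b F, (b, F) ∈ S → F.card = i → H i (chainSingle K S i (b, F)) =
      if t b ∈ F then 0 else -chainSingle K S (i + 1) (b, insert (t b) F) :=
    fun i b F hb hF => by
      rw [chainSingle_of_mem ⟨hb, hF⟩, Finsupp.linearCombination_single, one_smul,
        ChainIdx.toProd_ofMem]
  have hid : bd K S (j + 1) ∘ₗ H (j + 1) + H j ∘ₗ bd K S j = LinearMap.id := by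
    refine chain_hom_ext fun b F hb hF => ?_
    obtain ⟨v₀, hv₀⟩ : F.Nonempty := Finset.card_pos.1 (by omega)
    have htA := (ht b v₀ (hb.2 hv₀)).1
    have hcard : ∀ v ∈ F, (F.erase v).card = j := fun v hv => by
      rw [Finset.card_erase_of_mem hv, hF]; rfl
    have h₂ : H j (bd K S j (chainSingle K S (j + 1) (b, F))) = ∑ v ∈ F, faceSign K F v •
        if t b ∈ F.erase v then 0 else -chainSingle K S (j + 1) (b, insert (t b) (F.erase v)) := by
      rw [bd_chainSingle hb hF, map_sum]
      exact Finset.sum_congr rfl fun v hv => by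
        rw [map_smul, hH j b _ (simplexFaces_erase b F v hb) (hcard v hv)]
    rw [LinearMap.add_apply, comp_apply, comp_apply, h₂, hH _ b F hb hF, LinearMap.id_apply]
    by_cases htF : t b ∈ F
    · rw [if_pos htF, map_zero, zero_add, Finset.sum_eq_single (t b)]
      · have hs : faceSign K F (t b) = -1 := by
          have : (F.filter fun u => u ≤ t b) = {t b} := by
            ext u
            simp only [Finset.mem_filter, Finset.mem_singleton]
            exact ⟨fun h => le_antisymm h.2 (ht b u (hb.2 h.1)).2, fun h => h.symm ▸ ⟨htF, le_rfl⟩⟩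
          rw [faceSign, this]; simp
        rw [if_neg (Finset.notMem_erase _ _), Finset.insert_erase htF, hs]
        simp
      · intro v _ hv
        rw [if_pos (Finset.mem_erase.2 ⟨hv.symm, htF⟩), smul_zero]
      · exact fun h => absurd htF h
    · have hins : (b, insert (t b) F) ∈ S := ⟨hb.1, Finset.insert_subset htA hb.2⟩
      have hs : faceSign K (insert (t b) F) (t b) = -1 := by
        have : ((insert (t b) F).filter fun u => u ≤ t b) = {t b} := by
          ext u
          simp only [Finset.mem_filter, Finset.mem_singleton, Finset.mem_insert]
          refine ⟨fun h => h.1.elim id fun h' => le_antisymm h.2 (ht b u (hb.2 h')).2,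
            fun h => ⟨Or.inl h, h.le⟩⟩
        rw [faceSign, this]; simp
      have hs' : ∀ v ∈ F, faceSign K F v = -faceSign K (insert (t b) F) v := fun v hv => by
        have := faceSign_erase (K := K) (w := v) (Finset.mem_insert_self (t b) F)
        rwa [Finset.erase_insert htF, if_pos (ht b v (hb.2 hv)).2] at this
      rw [if_neg htF, map_neg, bd_chainSingle hins (by
        rw [Finset.card_insert_of_notMem htF, hF]), Finset.sum_insert htF, hs,
        Finset.erase_insert htF, neg_add, neg_smul, one_smul, neg_neg, add_assoc]
      refine add_eq_left.2 ?_
      rw [← Finset.sum_neg_distrib, ← Finset.sum_add_distrib]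
      refine Finset.sum_eq_zero fun v hv => ?_
      rw [if_neg fun h => htF (Finset.mem_of_mem_erase h), hs' v hv,
        Finset.erase_insert_of_ne fun h : t b = v => htF (h.symm ▸ hv)]
      simp
  intro z hz
  refine ⟨H (j + 1) z, ?_⟩
  have := LinearMap.congr_fun hid z
  rwa [LinearMap.add_apply, comp_apply, comp_apply, mem_ker.1 hz, map_zero, add_zero] at this

/-- In degree zero, exactly the simplices on the empty vertex set contribute homology. -/
theorem simplexFaces_mem_range_iff (L : Set α) (A : α → Finset ℕ)
    (z : ChainIdx (simplexFaces L A) 0 →₀ K) :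
    z ∈ range (bd K (simplexFaces L A) 0) ↔ ∀ b ∈ L, A b = ∅ → chainCoeff (b, ∅) z = 0 := by
  constructor
  · rintro ⟨y, rfl⟩ b hb hA
    have : chainCoeff (b, ∅) ∘ₗ bd K (simplexFaces L A) 0 = 0 := by
      refine chain_hom_ext fun c F hc hF => ?_
      rw [comp_apply, bd_chainSingle hc hF, map_sum, LinearMap.zero_apply]
      refine Finset.sum_eq_zero fun v hv => ?_
      rw [map_smul, chainCoeff_chainSingle _ _ ⟨simplexFaces_erase c F v hc, by
        rw [Finset.card_erase_of_mem hv, hF]⟩, if_neg, smul_zero]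
      intro e
      have hcb : c = b := congrArg Prod.fst e
      have := hc.2 hv
      rw [show A (c, F).1 = A b by rw [← hcb], hA] at this
      exact absurd this (Finset.notMem_empty _)
    exact LinearMap.congr_fun this y
  · intro h
    rw [← Finsupp.sum_single z]
    refine Submodule.sum_mem _ fun x _ => ?_
    obtain ⟨⟨b, F⟩, hx⟩ : ∃ y, y = x.toProd := ⟨_, rfl⟩
    have hmem := x.toProd_mem
    rw [← hx] at hmem
    obtain rfl := Finset.card_eq_zero.1 hmem.2
    rw [← mul_one (z x), ← smul_eq_mul, ← Finsupp.smul_single, ← chainSingle_toProd, ← hx]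
    by_cases hA : A b = ∅
    · rw [← chainCoeff_toProd, ← hx, h b hmem.1.1 hA, zero_smul]
      exact Submodule.zero_mem _
    · obtain ⟨v, hv⟩ := Finset.nonempty_iff_ne_empty.2 hA
      have hv' : (b, {v}) ∈ simplexFaces L A := ⟨hmem.1.1, Finset.singleton_subset_iff.2 hv⟩
      refine Submodule.smul_mem _ _ ⟨-chainSingle K _ 1 (b, {v}), ?_⟩
      rw [map_neg, bd_chainSingle hv' (Finset.card_singleton v), Finset.sum_singleton,
        Finset.erase_singleton, faceSign, Finset.filter_singleton, if_pos le_rfl]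
      simp

/-- The codimension of the boundaries in degree zero. -/
theorem simplexFaces_finrank_zero [Finite α] (L : Set α) (A : α → Finset ℕ) :
    finrank K (range (bd K (simplexFaces L A) 0)) + Nat.card {b // b ∈ L ∧ A b = ∅} =
      finrank K (ChainIdx (simplexFaces L A) 0 →₀ K) := by
  have := finite_chainIdx (S := simplexFaces L A) A (fun _ _ h => h.2) 0
  have := Fintype.ofFinite {b // b ∈ L ∧ A b = ∅}
  let ev : (ChainIdx (simplexFaces L A) 0 →₀ K) →ₗ[K] ({b // b ∈ L ∧ A b = ∅} → K) :=
    LinearMap.pi fun b => chainCoeff (b.1, ∅)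
  have hker : ker ev = range (bd K (simplexFaces L A) 0) := by
    ext z
    rw [simplexFaces_mem_range_iff, mem_ker, funext_iff]
    exact ⟨fun h b hb hA => h ⟨b, hb, hA⟩, fun h b => h b.1 b.2.1 b.2.2⟩
  have hrange : range ev = ⊤ := by
    refine range_eq_top.2 fun w => ?_
    refine ⟨chainOfCoeff fun x => if h : x.1 ∈ L ∧ A x.1 = ∅ then w ⟨x.1, h⟩ else 0, ?_⟩
    funext b
    have hb : (b.1, ∅) ∈ simplexFaces L A := ⟨b.2.1, Finset.empty_subset _⟩
    refine (chainCoeff_chainOfCoeff (j := 0) _ ⟨hb, rfl⟩).trans ?_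
    exact dif_pos b.2
  have h := finrank_range_add_finrank_ker ev
  rw [hrange, hker, finrank_top, finrank_pi, ← Nat.card_eq_fintype_card] at h
  omega

end Exactness

section Balancing

open Module LinearMap

variable {K : Type} [Field K]

/-- The homology of a labelled complex is counted by the labels with empty vertex set in a
resolution of it by disjoint unions of simplices. -/
theorem rhd_eq_card {α : ℕ → Type} [∀ q, Fintype (α q)] (S : ∀ q, Set (α q × Finset ℕ))
    (L : ∀ q, Set (α (q + 1))) (A : ∀ q, α (q + 1) → Finset ℕ)
    (hS : ∀ q, S (q + 1) = simplexFaces (L q) (A q)) (hfin : ∀ j, Finite (ChainIdx (S 0) j))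
    (m : ∀ q, α (q + 1) → α q → K)
    (hT : ∀ q b c F v, (b, F) ∈ S (q + 1) → m q b c ≠ 0 → v ∈ F → (c, F.erase v) ∈ S q →
      (c, F) ∈ S q)
    (hsurj : ∀ F, ∀ v : α 0 → K, ∃ w : α 1 → K, (∀ b, w b ≠ 0 → (b, F) ∈ S 1) ∧
      ∀ c, (c, F) ∈ S 0 → ∑ b, w b * m 0 b c = v c)
    (hrow : ∀ q F, ∀ v : α (q + 1) → K, (∀ b, v b ≠ 0 → (b, F) ∈ S (q + 1)) →
      ((∀ c, (c, F) ∈ S q → ∑ b, v b * m q b c = 0) ↔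
        ∃ w : α (q + 1 + 1) → K, (∀ g, w g ≠ 0 → (g, F) ∈ S (q + 1 + 1)) ∧
          ∀ b, (b, F) ∈ S (q + 1) → ∑ g, w g * m (q + 1) g b = v b))
    (hmin : ∀ q b c, b ∈ L (q + 1) → m (q + 1) b c ≠ 0 → A q c ≠ ∅) (p : ℕ) :
    rhd K (S 0) p = Nat.card {b // b ∈ L p ∧ A p b = ∅} := by
  have hfin' : ∀ p q, Finite (ChainIdx (S q) p) := fun p q => by
    cases q with
    | zero => exact hfin p
    | succ q =>
      rw [hS]
      exact finite_chainIdx (A q) (fun _ _ h => h.2) p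
  let δ : ∀ p q, (ChainIdx (S q) (p + 1) →₀ K) →ₗ[K] (ChainIdx (S q) p →₀ K) :=
    fun p q => bd K (S q) p
  let d : ∀ p q, (ChainIdx (S (q + 1)) p →₀ K) →ₗ[K] (ChainIdx (S q) p →₀ K) :=
    fun p q => labelMap (S (q + 1)) (S q) (m q) p
  have hcomm : ∀ p q, d p q ∘ₗ δ p (q + 1) = δ p q ∘ₗ d (p + 1) q := fun p q =>
    labelMap_comp_bd (m q) (by rw [hS]; exact simplexFaces_erase) (hT q) p
  have hsurj' : ∀ p, range (d p 0) = ⊤ := fun p => labelMap_range_eq_top _ hsurj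
  have hrow' : ∀ p q, ker (d p q) = range (d p (q + 1)) := fun p q =>
    labelMap_ker_eq_range _ _ (hrow q)
  have hcol : ∀ p q, ker (δ p (q + 1)) = range (δ (p + 1) (q + 1)) := fun p q => by
    simp only [δ]
    rw [hS]
    exact simplexFaces_ker_eq_range _ _ p
  have hrange : ∀ q (z : ChainIdx (S (q + 1)) 0 →₀ K), z ∈ range (δ 0 (q + 1)) ↔
      ∀ b ∈ L q, A q b = ∅ → chainCoeff (b, ∅) z = 0 := fun q => by
    simp only [δ]
    rw [hS]
    exact simplexFaces_mem_range_iff _ _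
  have hmin' : ∀ q, range (d 0 (q + 1)) ≤ range (δ 0 (q + 1)) := by
    rintro q _ ⟨y, rfl⟩
    refine (hrange q _).2 fun c hc hA => ?_
    rw [chainCoeff_labelMap _ _ (by rw [hS]; exact ⟨hc, Finset.empty_subset _⟩)]
    refine Finset.sum_eq_zero fun b _ => ?_
    by_cases hb : (b, (∅ : Finset ℕ)) ∈ S (q + 1 + 1)
    · rw [hS] at hb
      rw [not_not.1 fun h => hmin q b c hb.1 h hA, mul_zero]
    · rw [chainCoeff_of_notMem hb, zero_mul]
  have hcard : finrank K (range (δ 0 (p + 1))) + Nat.card {b // b ∈ L p ∧ A p b = ∅} =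
      finrank K (ChainIdx (S (p + 1)) 0 →₀ K) := by
    have key : ∀ X, X = simplexFaces (L p) (A p) → finrank K (range (bd K X 0)) +
        Nat.card {b // b ∈ L p ∧ A p b = ∅} = finrank K (ChainIdx X 0 →₀ K) := by
      rintro _ rfl
      exact simplexFaces_finrank_zero _ _
    exact key _ (hS p)
  have hbal := finrank_homology_zeroth_column (C := fun p q => ChainIdx (S q) p →₀ K) δ d
    hcomm hsurj' hrow' hcol hmin' p
  have hle := range_le_ker_zeroth_column (C := fun p q => ChainIdx (S q) p →₀ K) δ d hcomm
    hsurj' hcol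
  have hcyc : imageCycles (C := fun p q => ChainIdx (S q) p →₀ K) δ d p 0 = cycles K (S 0) p := by
    cases p with
    | zero => exact hsurj' 0
    | succ p =>
      change range (d (p + 1) 0) ⊓ ker (δ p 0) = ker (δ p 0)
      rw [hsurj', top_inf_eq]
  have hle' : range (bd K (S 0) p) ≤ cycles K (S 0) p := by
    cases p with
    | zero => exact le_top
    | succ p => exact hle p
  rw [rhd, inf_eq_left.2 hle', ← hcyc]
  change _ = _ + finrank K (range (bd K (S 0) p)) at hbal
  omega

end Balancing

section Strands

open Module LinearMap

variable {K : Type} [Field K] {n : ℕ}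

/-- The exponent vector of a nonnegative multidegree. -/
def expo (δ : Fin n → ℤ) : Fin n →₀ ℕ := Finsupp.equivFunOnFinite.symm fun j => (δ j).toNat

theorem expo_apply (δ : Fin n → ℤ) (j : Fin n) : expo δ j = (δ j).toNat := rfl

/-- The monomial of multidegree `δ ∈ ℤ^n` with a given coefficient, zero if `δ` is not
nonnegative. -/
def zmon (K : Type) [Field K] (δ : Fin n → ℤ) : K →ₗ[K] MvPolynomial (Fin n) K :=
  if 0 ≤ δ then MvPolynomial.monomial (expo δ) else 0

/-- The coefficient of a polynomial in multidegree `δ ∈ ℤ^n`. -/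
def zcoeff (K : Type) [Field K] (δ : Fin n → ℤ) : MvPolynomial (Fin n) K →ₗ[K] K :=
  if 0 ≤ δ then MvPolynomial.lcoeff K (expo δ) else 0

theorem zmon_of_nonneg {δ : Fin n → ℤ} (h : 0 ≤ δ) (r : K) :
    zmon K δ r = MvPolynomial.monomial (expo δ) r := by rw [zmon, if_pos h]

theorem zcoeff_of_nonneg {δ : Fin n → ℤ} (h : 0 ≤ δ) (f : MvPolynomial (Fin n) K) :
    zcoeff K δ f = MvPolynomial.coeff (expo δ) f := by rw [zcoeff, if_pos h]; rfl

theorem nonneg_of_zcoeff_ne_zero {δ : Fin n → ℤ} {f : MvPolynomial (Fin n) K}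
    (h : zcoeff K δ f ≠ 0) : 0 ≤ δ := by
  by_contra h'
  rw [zcoeff, if_neg h'] at h
  exact h rfl

theorem zcoeff_zmon {δ : Fin n → ℤ} (h : 0 ≤ δ) (r : K) : zcoeff K δ (zmon K δ r) = r := by
  rw [zcoeff_of_nonneg h, zmon_of_nonneg h, MvPolynomial.coeff_monomial, if_pos rfl]

theorem IsHomogZ.eq_zmon {f : MvPolynomial (Fin n) K} {δ : Fin n → ℤ} (hf : IsHomogZ K n f δ) :
    f = zmon K δ (zcoeff K δ f) := by
  by_cases h0 : f = 0
  · rw [h0, map_zero, map_zero]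
  have huniq : ∀ e ∈ f.support, e = expo δ := fun e he => by
    ext j
    have := hf e he j
    rw [expo_apply]
    omega
  obtain ⟨e, he⟩ := MvPolynomial.support_nonempty.2 h0
  have hδ : 0 ≤ δ := fun j => by
    have := hf e he j
    simp only [Pi.zero_apply]
    omega
  rw [zmon_of_nonneg hδ, zcoeff_of_nonneg hδ]
  ext e'
  rw [MvPolynomial.coeff_monomial]
  split_ifs with h
  · rw [h]
  · by_contra hne
    exact h (huniq e' (MvPolynomial.mem_support_iff.2 hne)).symm

theorem expo_add {δ ε : Fin n → ℤ} (hδ : 0 ≤ δ) (hε : 0 ≤ ε) :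
    expo (δ + ε) = expo δ + expo ε := by
  ext j
  have h₁ := hδ j
  have h₂ := hε j
  simp only [expo_apply, Finsupp.add_apply, Pi.add_apply, Pi.zero_apply] at *
  omega

theorem zmon_mul_zmon {β γ κ : Fin n → ℤ} {r s : K} (hr : r ≠ 0 → κ ≤ β) (hs : s ≠ 0 → β ≤ γ) :
    zmon K (β - κ) r * zmon K (γ - β) s = zmon K (γ - κ) (s * r) := by
  by_cases hr0 : r = 0
  · simp [hr0]
  by_cases hs0 : s = 0
  · simp [hs0]
  have h₁ := sub_nonneg.2 (hr hr0)
  have h₂ := sub_nonneg.2 (hs hs0)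
  rw [show γ - κ = (β - κ) + (γ - β) by abel, zmon_of_nonneg h₁, zmon_of_nonneg h₂,
    zmon_of_nonneg (add_nonneg h₁ h₂), expo_add h₁ h₂, MvPolynomial.monomial_mul, mul_comm]

theorem zcoeff_zmon_mul {β γ κ : Fin n → ℤ} {r : K} (hr : r ≠ 0 → κ ≤ β)
    (g : MvPolynomial (Fin n) K) :
    zcoeff K (γ - κ) (zmon K (β - κ) r * g) = zcoeff K (γ - β) g * r := by
  by_cases hr0 : r = 0
  · simp [hr0]
  have h₁ := sub_nonneg.2 (hr hr0)
  by_cases h₂ : 0 ≤ γ - β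
  · rw [show γ - κ = (β - κ) + (γ - β) by abel, zcoeff_of_nonneg (add_nonneg h₁ h₂),
      zcoeff_of_nonneg h₂, zmon_of_nonneg h₁, expo_add h₁ h₂, MvPolynomial.coeff_monomial_mul,
      mul_comm]
  · rw [zcoeff, zcoeff, if_neg h₂, LinearMap.zero_apply, zero_mul]
    split_ifs with h₃
    · rw [MvPolynomial.lcoeff_apply, zmon_of_nonneg h₁, MvPolynomial.coeff_monomial_mul', if_neg]
      intro hle
      refine h₂ fun j => ?_
      have a₁ := hle j
      have a₂ := h₁ j
      have a₃ := h₃ j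
      simp only [expo_apply, Pi.sub_apply, Pi.zero_apply] at *
      omega
    · rfl

theorem zcoeff_eq_zero_of_mem {I : Ideal (MvPolynomial (Fin n) K)} (hI : IsMonomialIdeal K n I)
    {γ : Fin n → ℤ} (hγ : zmon K γ 1 ∉ I) {f : MvPolynomial (Fin n) K} (hf : f ∈ I) :
    zcoeff K γ f = 0 := by
  obtain ⟨S, rfl⟩ := hI
  have himage : mon K n '' S = (fun s => MvPolynomial.monomial s (1 : K)) ''
      (Finsupp.equivFunOnFinite.symm '' S) := by
    rw [Set.image_image]; rfl
  by_contra hne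
  have h0 := nonneg_of_zcoeff_ne_zero hne
  rw [zcoeff_of_nonneg h0] at hne
  rw [himage, MvPolynomial.mem_ideal_span_monomial_image] at hf
  rw [himage, MvPolynomial.mem_ideal_span_monomial_image, zmon_of_nonneg h0] at hγ
  refine hγ fun e he => ?_
  obtain rfl : e = expo γ := by
    by_contra h
    rw [MvPolynomial.mem_support_iff, MvPolynomial.coeff_monomial, if_neg (Ne.symm h)] at he
    exact he rfl
  exact hf _ (MvPolynomial.mem_support_iff.2 hne)

theorem zmon_mem_of_le {I : Ideal (MvPolynomial (Fin n) K)} {γ γ' : Fin n → ℤ} (h0 : 0 ≤ γ)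
    (hle : γ ≤ γ') (h : zmon K γ 1 ∈ I) : zmon K γ' 1 ∈ I := by
  have := zmon_mul_zmon (K := K) (κ := 0) (r := 1) (s := 1) (fun _ => h0) (fun _ => hle)
  rw [sub_zero, sub_zero, one_mul] at this
  rw [← this]
  exact I.mul_mem_right _ h

variable {B : ℕ → Type}
  {Mtx : ∀ i, B (i + 1) → B i → MvPolynomial (Fin n) K} {I : Ideal (MvPolynomial (Fin n) K)}
  {dg : ∀ i, B i → Fin n → ℤ} {aug : B 0 → MvPolynomial (Fin n) K}

/-- The scalar entries of the differentials. -/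
def scalarEntry (Mtx : ∀ i, B (i + 1) → B i → MvPolynomial (Fin n) K)
    (dg : ∀ i, B i → Fin n → ℤ) (i : ℕ) (b : B (i + 1)) (c : B i) : K :=
  zcoeff K (dg (i + 1) b - dg i c) (Mtx i b c)

/-- The homogeneous vector of multidegree `γ` with given coefficients. -/
def strand (dg : ∀ i, B i → Fin n → ℤ) (γ : Fin n → ℤ) {i : ℕ} (v : B i → K) :
    B i → MvPolynomial (Fin n) K :=
  fun b => zmon K (γ - dg i b) (v b)

theorem le_of_scalarEntry_ne_zero {i : ℕ} {b : B (i + 1)} {c : B i}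
    (h : scalarEntry Mtx dg i b c ≠ 0) : dg i c ≤ dg (i + 1) b :=
  sub_nonneg.1 (nonneg_of_zcoeff_ne_zero h)

theorem strand_eq_zero_iff {i : ℕ} {γ : Fin n → ℤ} {v : B i → K} :
    strand dg γ v = 0 ↔ ∀ b, dg i b ≤ γ → v b = 0 := by
  constructor
  · intro h b hb
    rw [← zcoeff_zmon (sub_nonneg.2 hb) (v b)]
    exact (congrArg _ (congrFun h b)).trans (map_zero _)
  · intro h
    funext b
    by_cases hb : dg i b ≤ γ
    · rw [strand, h b hb, map_zero]; rfl
    · rw [strand, zmon, if_neg fun h' => hb (sub_nonneg.1 h')]; rfl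

variable [∀ i, Fintype (B i)]

theorem IsMinimalFreeResolution.eq_zmon (hres : IsMinimalFreeResolution K n B Mtx I dg aug)
    (i : ℕ) (b : B (i + 1)) (c : B i) :
    Mtx i b c = zmon K (dg (i + 1) b - dg i c) (scalarEntry Mtx dg i b c) :=
  (hres.1 i b c).eq_zmon

theorem IsMinimalFreeResolution.degree_ne (hres : IsMinimalFreeResolution K n B Mtx I dg aug)
    {i : ℕ} {b : B (i + 1)} {c : B i} (h : scalarEntry Mtx dg i b c ≠ 0) :
    dg (i + 1) b ≠ dg i c := by
  intro e
  refine h ?_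
  have e0 : expo (0 : Fin n → ℤ) = 0 := by ext; rfl
  rw [scalarEntry, e, sub_self, zcoeff_of_nonneg le_rfl, e0]
  exact hres.2.2.1 i b c

theorem IsMinimalFreeResolution.resD_strand (hres : IsMinimalFreeResolution K n B Mtx I dg aug)
    {i : ℕ} {γ : Fin n → ℤ} {v : B (i + 1) → K} (hv : ∀ b, v b ≠ 0 → dg (i + 1) b ≤ γ) :
    resD K n B Mtx i (strand dg γ v) =
      strand dg γ fun c => ∑ b, v b * scalarEntry Mtx dg i b c := by
  funext c
  change ∑ b, Mtx i b c * zmon K _ _ = zmon K _ _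
  rw [map_sum]
  refine Finset.sum_congr rfl fun b _ => ?_
  rw [hres.eq_zmon, zmon_mul_zmon le_of_scalarEntry_ne_zero (hv b)]

theorem IsMinimalFreeResolution.zcoeff_resD (hres : IsMinimalFreeResolution K n B Mtx I dg aug)
    {i : ℕ} (γ : Fin n → ℤ) (g : B (i + 1) → MvPolynomial (Fin n) K) (c : B i) :
    zcoeff K (γ - dg i c) (resD K n B Mtx i g c) =
      ∑ b, zcoeff K (γ - dg (i + 1) b) (g b) * scalarEntry Mtx dg i b c := by
  change zcoeff K _ (∑ b, Mtx i b c * g b) = _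
  rw [map_sum]
  refine Finset.sum_congr rfl fun b _ => ?_
  rw [hres.eq_zmon, zcoeff_zmon_mul le_of_scalarEntry_ne_zero]

/-- The scalar entries of the augmentation. -/
def scalarAug (aug : B 0 → MvPolynomial (Fin n) K) (dg : ∀ i, B i → Fin n → ℤ) (b : B 0) : K :=
  zcoeff K (dg 0 b) (aug b)

theorem IsMinimalFreeResolution.augLin_strand
    (hres : IsMinimalFreeResolution K n B Mtx I dg aug)
    {γ : Fin n → ℤ} {v : B 0 → K} (hv : ∀ b, v b ≠ 0 → dg 0 b ≤ γ) :
    augLin K n B aug (strand dg γ v) = zmon K γ (∑ b, v b * scalarAug aug dg b) := by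
  change ∑ b, aug b * zmon K _ _ = zmon K _ _
  rw [map_sum]
  refine Finset.sum_congr rfl fun b _ => ?_
  have := zmon_mul_zmon (κ := 0) (r := scalarAug aug dg b)
    (fun h => nonneg_of_zcoeff_ne_zero h) (hv b)
  rwa [sub_zero, sub_zero, scalarAug, ← (hres.2.1 b).eq_zmon] at this

theorem IsMinimalFreeResolution.zcoeff_augLin
    (hres : IsMinimalFreeResolution K n B Mtx I dg aug)
    (γ : Fin n → ℤ) (g : B 0 → MvPolynomial (Fin n) K) :
    zcoeff K γ (augLin K n B aug g) =
      ∑ b, zcoeff K (γ - dg 0 b) (g b) * scalarAug aug dg b := by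
  change zcoeff K _ (∑ b, aug b * g b) = _
  rw [map_sum]
  refine Finset.sum_congr rfl fun b _ => ?_
  have := zcoeff_zmon_mul (κ := 0) (γ := γ) (r := scalarAug aug dg b)
    (fun h => nonneg_of_zcoeff_ne_zero h) (g b)
  rwa [sub_zero, sub_zero, scalarAug, ← (hres.2.1 b).eq_zmon] at this

/-- A vector of scalars is hit in multidegree `γ` iff its strand is a boundary. -/
theorem IsMinimalFreeResolution.strand_mem_range_iff
    (hres : IsMinimalFreeResolution K n B Mtx I dg aug)
    {i : ℕ} {γ : Fin n → ℤ} {v : B i → K} (hv : ∀ b, v b ≠ 0 → dg i b ≤ γ) :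
    strand dg γ v ∈ range (resD K n B Mtx i) ↔
      ∃ w : B (i + 1) → K, (∀ g, w g ≠ 0 → dg (i + 1) g ≤ γ) ∧
        ∀ b, dg i b ≤ γ → ∑ g, w g * scalarEntry Mtx dg i g b = v b := by
  constructor
  · rintro ⟨g, hg⟩
    refine ⟨fun b => zcoeff K (γ - dg (i + 1) b) (g b),
      fun b hb => sub_nonneg.1 (nonneg_of_zcoeff_ne_zero hb), fun b hb => ?_⟩
    rw [← hres.zcoeff_resD, hg]
    exact zcoeff_zmon (sub_nonneg.2 hb) _
  · rintro ⟨w, hw, hwv⟩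
    refine ⟨strand dg γ w, ?_⟩
    rw [hres.resD_strand hw]
    congr 1
    funext b
    by_cases hb : dg i b ≤ γ
    · exact hwv b hb
    · rw [not_not.1 (mt (hv b) hb)]
      refine Finset.sum_eq_zero fun g _ => ?_
      by_contra hne
      exact hb ((le_of_scalarEntry_ne_zero (right_ne_zero_of_mul hne)).trans
        (hw g (left_ne_zero_of_mul hne)))

theorem IsMinimalFreeResolution.strand_exact
    (hres : IsMinimalFreeResolution K n B Mtx I dg aug)
    {i : ℕ} {γ : Fin n → ℤ} {v : B (i + 1) → K} (hv : ∀ b, v b ≠ 0 → dg (i + 1) b ≤ γ) :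
    (∀ c, dg i c ≤ γ → ∑ b, v b * scalarEntry Mtx dg i b c = 0) ↔
      ∃ w : B (i + 1 + 1) → K, (∀ g, w g ≠ 0 → dg (i + 1 + 1) g ≤ γ) ∧
        ∀ b, dg (i + 1) b ≤ γ → ∑ g, w g * scalarEntry Mtx dg (i + 1) g b = v b := by
  rw [← hres.strand_mem_range_iff hv, ← hres.2.2.2.2.2 i, mem_ker, hres.resD_strand hv,
    strand_eq_zero_iff]

theorem IsMinimalFreeResolution.strand_exact_zero
    (hres : IsMinimalFreeResolution K n B Mtx I dg aug) (hI : IsMonomialIdeal K n I)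
    {γ : Fin n → ℤ} {v : B 0 → K} (hv : ∀ b, v b ≠ 0 → dg 0 b ≤ γ) :
    (0 ≤ γ ∧ zmon K γ 1 ∉ I → ∑ b, v b * scalarAug aug dg b = 0) ↔
      ∃ w : B 1 → K, (∀ g, w g ≠ 0 → dg 1 g ≤ γ) ∧
        ∀ b, dg 0 b ≤ γ → ∑ g, w g * scalarEntry Mtx dg 0 g b = v b := by
  rw [← hres.strand_mem_range_iff hv, ← hres.2.2.2.2.1, hres.augLin_strand hv]
  constructor
  · intro h
    by_cases h0 : 0 ≤ γ
    · by_cases hγ : zmon K γ 1 ∈ I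
      · have := I.mul_mem_left (MvPolynomial.C (∑ b, v b * scalarAug aug dg b)) hγ
        rwa [← MvPolynomial.smul_eq_C_mul, ← map_smul, smul_eq_mul, mul_one] at this
      · rw [h ⟨h0, hγ⟩, map_zero]
        exact I.zero_mem
    · rw [zmon, if_neg h0]
      exact I.zero_mem
  · rintro h ⟨h0, hγ⟩
    rw [← zcoeff_zmon h0 (∑ b, _), zcoeff_eq_zero_of_mem hI hγ h]

theorem IsMinimalFreeResolution.strand_surjective
    (hres : IsMinimalFreeResolution K n B Mtx I dg aug) (hI : IsMonomialIdeal K n I)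
    {γ : Fin n → ℤ} (h0 : 0 ≤ γ) (hγ : zmon K γ 1 ∉ I) (r : K) :
    ∃ w : B 0 → K, (∀ b, w b ≠ 0 → dg 0 b ≤ γ) ∧ ∑ b, w b * scalarAug aug dg b = r := by
  obtain ⟨g, hg⟩ := hres.2.2.2.1 (zmon K γ r)
  refine ⟨fun b => zcoeff K (γ - dg 0 b) (g b),
    fun b hb => sub_nonneg.1 (nonneg_of_zcoeff_ne_zero hb), ?_⟩
  have := zcoeff_eq_zero_of_mem hI hγ hg
  rw [map_sub, zcoeff_zmon h0, sub_eq_zero] at this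
  rw [← hres.zcoeff_augLin, this]

end Strands

section KoszulBalancing

variable {K : Type} [Field K] {n : ℕ}

/-- The multidegree `a - e_F`, as an integer vector. -/
def shiftDeg (a : Fin n → ℕ) (F : Finset ℕ) : Fin n → ℤ := fun t => (a t : ℤ) - eF F t

/-- The positions in which the multidegree `δ` is strictly smaller than `a`. -/
def slack (a : Fin n → ℕ) (δ : Fin n → ℤ) : Finset ℕ :=
  (Finset.univ.filter fun t => δ t < a t).map Fin.valEmbedding

theorem val_mem_slack {a : Fin n → ℕ} {δ : Fin n → ℤ} (t : Fin n) :
    (t : ℕ) ∈ slack a δ ↔ δ t < a t := by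
  simp [slack, Fin.val_inj]

theorem slack_subset_range (a : Fin n → ℕ) (δ : Fin n → ℤ) : slack a δ ⊆ Finset.range n := by
  intro v hv
  obtain ⟨t, -, rfl⟩ := Finset.mem_map.1 hv
  exact Finset.mem_range.2 t.2

theorem slack_eq_empty_iff {a : Fin n → ℕ} {δ : Fin n → ℤ} :
    slack a δ = ∅ ↔ ∀ t, (a t : ℤ) ≤ δ t := by
  simp [slack, Finset.filter_eq_empty_iff]

theorem le_shiftDeg_iff {a : Fin n → ℕ} {δ : Fin n → ℤ} {F : Finset ℕ}
    (hF : F ⊆ Finset.range n) :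
    δ ≤ shiftDeg a F ↔ (∀ t, δ t ≤ a t) ∧ F ⊆ slack a δ := by
  constructor
  · intro h
    refine ⟨fun t => (h t).trans (by simp [shiftDeg]), fun v hv => ?_⟩
    have ht := h ⟨v, Finset.mem_range.1 (hF hv)⟩
    rw [show v = ((⟨v, Finset.mem_range.1 (hF hv)⟩ : Fin n) : ℕ) from rfl, val_mem_slack]
    simp only [shiftDeg, eF, hv, if_true] at ht
    omega
  · rintro ⟨h, hs⟩ t
    simp only [shiftDeg, eF]
    split_ifs with ht
    · have := (val_mem_slack t).1 (hs ht)
      omega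
    · have := h t
      omega

theorem shiftDeg_le_erase (a : Fin n → ℕ) (F : Finset ℕ) (v : ℕ) :
    shiftDeg a F ≤ shiftDeg a (F.erase v) := by
  intro t
  simp only [shiftDeg, eF]
  split_ifs with h₁ h₂ h₂
  · rfl
  · omega
  · exact absurd (Finset.mem_of_mem_erase h₂) h₁
  · rfl

theorem mem_lab_KosQ_iff {I : Ideal (MvPolynomial (Fin n) K)} {a : Fin n → ℕ} {u : Unit}
    {F : Finset ℕ} :
    (u, F) ∈ lab (KosQ K n I a) ↔
      F ⊆ Finset.range n ∧ 0 ≤ shiftDeg a F ∧ zmon K (shiftDeg a F) 1 ∉ I := by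
  have h0 : (∀ i : Fin n, (i : ℕ) ∈ F → 1 ≤ a i) ↔ 0 ≤ shiftDeg a F := by
    refine forall_congr' fun t => ?_
    simp only [shiftDeg, eF, Pi.zero_apply]
    split_ifs with h
    · simp [h]
    · simp [h]
  change _ ∧ _ ∧ _ ↔ _
  rw [h0]
  refine and_congr_right fun _ => and_congr_right fun hle => ?_
  have : expo (shiftDeg a F) = Finsupp.equivFunOnFinite.symm fun i => a i - eF F i.val := by
    ext t
    rw [expo_apply]
    simp only [shiftDeg, Finsupp.equivFunOnFinite_symm_apply_apply]
    omega
  rw [zmon_of_nonneg hle, this]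
  rfl

/-- The labels of the terms of a resolution, preceded by the single label of `R/I`. -/
def resLabel (B : ℕ → Type) : ℕ → Type
  | 0 => Unit
  | q + 1 => B q

instance resLabelFintype (B : ℕ → Type) [h : ∀ i, Fintype (B i)] : ∀ q, Fintype (resLabel B q)
  | 0 => inferInstanceAs (Fintype Unit)
  | q + 1 => h q

variable {B : ℕ → Type}

/-- The labelled faces indexing the tensor product of the Koszul complex with the terms of a
resolution of `R/I`, preceded by `R/I` itself, in multidegree `a`. -/
def resFaces (I : Ideal (MvPolynomial (Fin n) K)) (dg : ∀ i, B i → Fin n → ℤ) (a : Fin n → ℕ) :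
    ∀ q, Set (resLabel B q × Finset ℕ)
  | 0 => lab (KosQ K n I a)
  | q + 1 => simplexFaces {b : B q | ∀ t, dg q b t ≤ a t} fun b => slack a (dg q b)

theorem mem_resFaces_succ_iff {I : Ideal (MvPolynomial (Fin n) K)} {dg : ∀ i, B i → Fin n → ℤ}
    {a : Fin n → ℕ} {q : ℕ} {b : B q} {F : Finset ℕ} :
    (b, F) ∈ resFaces I dg a (q + 1) ↔ F ⊆ Finset.range n ∧ dg q b ≤ shiftDeg a F := by
  constructor
  · intro h
    have hF : F ⊆ Finset.range n := h.2.trans (slack_subset_range _ _)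
    exact ⟨hF, (le_shiftDeg_iff hF).2 h⟩
  · rintro ⟨hF, h⟩
    exact (le_shiftDeg_iff hF).1 h

variable [∀ i, Fintype (B i)]
  {Mtx : ∀ i, B (i + 1) → B i → MvPolynomial (Fin n) K} {I : Ideal (MvPolynomial (Fin n) K)}
  {dg : ∀ i, B i → Fin n → ℤ} {aug : B 0 → MvPolynomial (Fin n) K}

/-- The scalar entries of the augmented resolution. -/
def resEntry (Mtx : ∀ i, B (i + 1) → B i → MvPolynomial (Fin n) K)
    (dg : ∀ i, B i → Fin n → ℤ) (aug : B 0 → MvPolynomial (Fin n) K) :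
    ∀ q, resLabel B (q + 1) → resLabel B q → K
  | 0 => fun b _ => scalarAug aug dg b
  | q + 1 => scalarEntry Mtx dg q

theorem IsMinimalFreeResolution.torQDim_eq_card
    (hres : IsMinimalFreeResolution K n B Mtx I dg aug) (hI : IsMonomialIdeal K n I)
    (i : ℕ) (a : Fin n → ℕ) :
    torQDim K n I i a = Nat.card {b : B i // dg i b = fun t => (a t : ℤ)} := by
  have key := rhd_eq_card (K := K) (α := resLabel B) (resFaces I dg a)
    (fun q => {b : B q | ∀ t, dg q b t ≤ a t}) (fun q (b : B q) => slack a (dg q b))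
    (fun _ => rfl)
    (fun j => finite_chainIdx (α := Unit) (fun _ => Finset.range n) (fun _ _ h => h.1) j)
    (resEntry Mtx dg aug) ?_ ?_ ?_ ?_ i
  · refine key.trans (Nat.card_congr (Equiv.subtypeEquivRight fun b => ?_))
    rw [slack_eq_empty_iff, funext_iff]
    exact ⟨fun h t => le_antisymm (h.1 t) (h.2 t),
      fun h => ⟨fun t => (h t).le, fun t => (h t).ge⟩⟩
  · rintro (_ | q) b c F v hb hne - hc
    · obtain ⟨hF, hle⟩ := mem_resFaces_succ_iff.1 hb
      have h0 : 0 ≤ shiftDeg a F := (nonneg_of_zcoeff_ne_zero hne).trans hle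
      exact mem_lab_KosQ_iff.2 ⟨hF, h0, fun h => (mem_lab_KosQ_iff.1 hc).2.2
        (zmon_mem_of_le h0 (shiftDeg_le_erase a F v) h)⟩
    · obtain ⟨hF, hle⟩ := mem_resFaces_succ_iff.1 hb
      exact mem_resFaces_succ_iff.2 ⟨hF, (le_of_scalarEntry_ne_zero (Mtx := Mtx) hne).trans hle⟩
  · intro F v
    by_cases hF : ((), F) ∈ lab (KosQ K n I a)
    · obtain ⟨hr, h0, hγ⟩ := mem_lab_KosQ_iff.1 hF
      obtain ⟨w, hw, hwv⟩ := hres.strand_surjective hI h0 hγ (v ())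
      exact ⟨w, fun b hb => mem_resFaces_succ_iff.2 ⟨hr, hw b hb⟩, fun _ _ => hwv⟩
    · exact ⟨0, fun b hb => absurd rfl hb, fun _ hc => absurd hc hF⟩
  · intro q F v hv
    by_cases hF : F ⊆ Finset.range n
    · have hv' : ∀ b, v b ≠ 0 → dg q b ≤ shiftDeg a F := fun b hb =>
        (mem_resFaces_succ_iff.1 (hv b hb)).2
      have hmem : ∀ (p : ℕ) (b : B p), (b, F) ∈ resFaces I dg a (p + 1) ↔
          dg p b ≤ shiftDeg a F := fun p b => mem_resFaces_succ_iff.trans (and_iff_right hF)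
      have hright : (∃ w : resLabel B (q + 1 + 1) → K,
          (∀ g, w g ≠ 0 → (g, F) ∈ resFaces I dg a (q + 1 + 1)) ∧
          ∀ b, (b, F) ∈ resFaces I dg a (q + 1) →
            ∑ g, w g * resEntry Mtx dg aug (q + 1) g b = v b) ↔
          ∃ w : B (q + 1) → K, (∀ g, w g ≠ 0 → dg (q + 1) g ≤ shiftDeg a F) ∧
            ∀ b, dg q b ≤ shiftDeg a F → ∑ g, w g * scalarEntry Mtx dg q g b = v b :=
        exists_congr fun w => and_congr
          (forall_congr' fun g => imp_congr_right fun _ => hmem (q + 1) g)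
          (forall_congr' fun b => imp_congr_left (hmem q b))
      rw [hright]
      cases q with
      | zero =>
        rw [← hres.strand_exact_zero hI hv']
        exact ⟨fun h h' => h () (mem_lab_KosQ_iff.2 ⟨hF, h'⟩),
          fun h _ h' => h (mem_lab_KosQ_iff.1 h').2⟩
      | succ q =>
        rw [← hres.strand_exact hv']
        exact forall_congr' fun c => imp_congr_left (hmem q c)
    · have hnot : ∀ (p : ℕ) (b : B p), (b, F) ∉ resFaces I dg a (p + 1) := fun p b h =>
        hF (mem_resFaces_succ_iff.1 h).1
      refine ⟨fun _ => ⟨0, fun g hg => absurd rfl hg, fun b hb => absurd hb (hnot q b)⟩,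
        fun _ c _ => Finset.sum_eq_zero fun b _ => ?_⟩
      rw [not_not.1 (mt (hv b) (hnot q b)), zero_mul]
  · intro q b c hb hne hc
    refine hres.degree_ne hne
      (le_antisymm (fun t => ?_) (le_of_scalarEntry_ne_zero (Mtx := Mtx) hne))
    exact (hb t).trans (slack_eq_empty_iff.1 hc t)

theorem torQDim_eq_zero_of_lt {i : ℕ} (hi : n < i) (a : Fin n → ℕ) : torQDim K n I i a = 0 := by
  have : IsEmpty (ChainIdx (lab (KosQ K n I a)) i) := ⟨fun x => by
    have h := Finset.card_le_card (show x.1.2 ⊆ Finset.range n from x.2.1.1)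
    rw [x.2.2, Finset.card_range] at h
    omega⟩
  have hz : Module.finrank K (cycles K (lab (KosQ K n I a)) i) = 0 :=
    Module.finrank_zero_of_subsingleton
  rw [torQDim, rhd0, rhd, hz, Nat.zero_sub]

end KoszulBalancing

section Extremal

open Module

variable {K : Type} [Field K] {n : ℕ}

/-- If `a` dominates a rearrangement of the partition `l`, then so does the partition obtained
by sorting `a`. -/
theorem exists_antitone_rearrangement {l a : Fin n → ℕ} (hl : Antitone l)
    {σ : Equiv.Perm (Fin n)} (h : ∀ t, l (σ t) ≤ a t) :
    ∃ μ : Fin n → ℕ, Antitone μ ∧ (∀ t, l t ≤ μ t) ∧ ∃ τ : Equiv.Perm (Fin n), a = μ ∘ τ := by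
  let τ := Tuple.sort fun t => OrderDual.toDual (a t)
  have hτ : Antitone (a ∘ τ) := Tuple.monotone_sort fun t => OrderDual.toDual (a t)
  refine ⟨a ∘ τ, hτ, fun t => ?_, τ.symm, by ext; simp⟩
  by_contra! hlt
  have hmaps : ∀ s ∈ Finset.Iic t, τ.symm (σ.symm s) ∈ Finset.Iio t := by
    intro s hs
    rw [Finset.mem_Iio]
    by_contra! hts
    have h₁ := hτ hts
    have h₂ := h (σ.symm s)
    have h₃ := hl (Finset.mem_Iic.1 hs)
    simp only [Function.comp_apply, Equiv.apply_symm_apply] at *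
    omega
  have := Finset.card_le_card_of_injOn _ hmaps
    fun x _ y _ hxy => σ.symm.injective (τ.symm.injective hxy)
  simp at this

theorem IsHomogZ.nonneg {f : MvPolynomial (Fin n) K} {δ : Fin n → ℤ} (hf : IsHomogZ K n f δ)
    (h0 : f ≠ 0) : 0 ≤ δ := by
  by_contra h
  refine h0 (hf.eq_zmon.trans ?_)
  rw [zmon, if_neg h]
  rfl

theorem isHomogZ_C {δ : Fin n → ℤ} (hδ : ∀ t, δ t = 0) (r : K) :
    IsHomogZ K n (MvPolynomial.C r) δ := by
  intro e he t
  have h0 : e = 0 := by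
    by_contra hne
    rw [MvPolynomial.mem_support_iff, MvPolynomial.coeff_C, if_neg (Ne.symm hne)] at he
    exact he rfl
  rw [h0, hδ]
  rfl

variable {B : ℕ → Type} [∀ i, Fintype (B i)]
  {Mtx : ∀ i, B (i + 1) → B i → MvPolynomial (Fin n) K} {I : Ideal (MvPolynomial (Fin n) K)}
  {dg : ∀ i, B i → Fin n → ℤ} {aug : B 0 → MvPolynomial (Fin n) K}

theorem IsMinimalFreeResolution.torQDim_ne_zero_iff
    (hres : IsMinimalFreeResolution K n B Mtx I dg aug) (hI : IsMonomialIdeal K n I)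
    {i : ℕ} {a : Fin n → ℕ} :
    torQDim K n I i a ≠ 0 ↔ ∃ b : B i, dg i b = fun t => (a t : ℤ) := by
  rw [hres.torQDim_eq_card hI, ← Nat.pos_iff_ne_zero, Nat.card_pos_iff, nonempty_subtype]
  exact and_iff_left inferInstance

theorem IsMinimalFreeResolution.torQDimSym_ne_zero_iff
    (hres : IsMinimalFreeResolution K n B Mtx I dg aug) (hI : IsMonomialIdeal K n I)
    {i : ℕ} {μ : Fin n → ℕ} :
    torQDimSym K n I i μ ≠ 0 ↔
      ∃ (b : B i) (σ : Equiv.Perm (Fin n)), ∀ t, dg i b t = μ (σ t) := by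
  rw [torQDimSym, Ne, Finset.sum_eq_zero_iff]
  push Not
  simp only [Finset.mem_image, Finset.mem_univ, true_and, exists_exists_eq_and]
  rw [exists_comm]
  refine exists_congr fun σ => (hres.torQDim_ne_zero_iff hI).trans ?_
  exact exists_congr fun b => funext_iff

theorem le_of_torQDimSym_ne_zero {i : ℕ} {μ : Fin n → ℕ} (h : torQDimSym K n I i μ ≠ 0) :
    i ≤ n := by
  by_contra! hi
  exact h (Finset.sum_eq_zero fun a _ => torQDim_eq_zero_of_lt hi a)

theorem sum_natCast_comp (l : Fin n → ℕ) (σ : Equiv.Perm (Fin n)) :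
    ∑ t, (l (σ t) : ℤ) = ∑ t, (l t : ℤ) :=
  Equiv.sum_comp σ fun t => (l t : ℤ)

/-- A generator of a resolution that dominates an extremal pair has the extremal degree. -/
theorem IsExtremalPair.degree_eq (hres : IsMinimalFreeResolution K n B Mtx I dg aug)
    (hI : IsMonomialIdeal K n I) {i : ℕ} {l : Fin n → ℕ} (hext : IsExtremalPair K n I i l)
    {j : ℕ} (hij : i ≤ j) {b : B j} {σ : Equiv.Perm (Fin n)}
    (hle : ∀ t, (l (σ t) : ℤ) ≤ dg j b t)
    (hsum : ∑ t, (l t : ℤ) - i ≤ ∑ t, dg j b t - j) (t : Fin n) :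
    dg j b t = l (σ t) := by
  have hnat : ∀ t, dg j b t = ((dg j b t).toNat : ℤ) := fun t => by
    have := hle t
    omega
  obtain ⟨μ, hμ, hlμ, τ, hτ⟩ := exists_antitone_rearrangement (a := fun t => (dg j b t).toNat)
    hext.2.2.1 (σ := σ) fun t => by have := hle t; omega
  have hdg : ∀ t, dg j b t = μ (τ t) := fun t => by
    rw [hnat t]
    exact congrArg Nat.cast (congrFun hτ t)
  have hsumμ : ∑ t, dg j b t = ∑ t, (μ t : ℤ) := by
    rw [← sum_natCast_comp μ τ]
    exact Finset.sum_congr rfl fun t _ => hdg t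
  obtain rfl : l = μ := by
    by_contra hne
    exact (hres.torQDimSym_ne_zero_iff hI).2 ⟨b, τ, hdg⟩
      (hext.2.2.2.2 j μ hij hμ hlμ hne (hsumμ ▸ hsum))
  rw [← sum_natCast_comp l σ] at hsumμ
  exact ((Finset.sum_eq_sum_iff_of_le fun t _ => hle t).1 hsumμ.symm t (Finset.mem_univ t)).symm

/-- The differential does not involve generators of extremal degree. -/
theorem IsExtremalPair.entry_eq_zero (hres : IsMinimalFreeResolution K n B Mtx I dg aug)
    (hI : IsMonomialIdeal K n I) {i : ℕ} {l : Fin n → ℕ} (hext : IsExtremalPair K n I i l)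
    {b : B i} {σ : Equiv.Perm (Fin n)} (hb : ∀ t, dg i b t = l (σ t)) (g : B (i + 1)) :
    Mtx i g b = 0 := by
  rw [hres.eq_zmon]
  by_cases h0 : scalarEntry Mtx dg i g b = 0
  · rw [h0, map_zero]
  have hle := le_of_scalarEntry_ne_zero h0
  have hlt : ∑ t, dg i b t < ∑ t, dg (i + 1) g t := by
    refine lt_of_le_of_ne (Finset.sum_le_sum fun t _ => hle t) fun he => hres.degree_ne h0 ?_
    exact funext fun t =>
      ((Finset.sum_eq_sum_iff_of_le fun t _ => hle t).1 he t (Finset.mem_univ t)).symm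
  have hsum : ∑ t, dg i b t = ∑ t, (l t : ℤ) :=
    (Finset.sum_congr rfl fun t _ => hb t).trans (sum_natCast_comp l σ)
  have := hext.degree_eq hres hI (j := i + 1) (Nat.le_add_right i 1) (b := g) (σ := σ)
    (fun t => hb t ▸ hle t) (by push_cast; omega)
  exact absurd (funext fun t => (this t).trans (hb t).symm) (hres.degree_ne h0)

theorem IsMinimalFreeResolution.coeff_zero_of_mem_dualBd
    (hres : IsMinimalFreeResolution K n B Mtx I dg aug) {i : ℕ}
    {z : B i → MvPolynomial (Fin n) K} (hz : z ∈ dualBd K n B Mtx i) (b : B i) :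
    MvPolynomial.coeff 0 (z b) = 0 := by
  cases i with
  | zero =>
    rw [(Submodule.mem_bot _).1 hz]
    rfl
  | succ i =>
    obtain ⟨y, rfl⟩ := hz
    change MvPolynomial.constantCoeff (∑ c, Mtx i b c * y c) = 0
    rw [map_sum]
    refine Finset.sum_eq_zero fun c _ => ?_
    rw [map_mul, MvPolynomial.constantCoeff_eq, hres.2.2.1, zero_mul]

theorem ExtNZ.exists_degree_le {i : ℕ} {a : Fin n → ℤ} (h : ExtNZ K n B Mtx dg i a) :
    ∃ b : B i, ∀ t, a t ≤ dg i b t := by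
  obtain ⟨z, hz, -, hbd⟩ := h
  obtain ⟨b, hb⟩ : ∃ b, z b ≠ 0 := by
    by_contra! h0
    exact hbd (by rw [show z = 0 from funext h0]; exact zero_mem _)
  exact ⟨b, fun t => sub_nonneg.1 ((hz b).nonneg hb t)⟩

theorem IsExtremalPair.isExtExtremalPair (hres : IsMinimalFreeResolution K n B Mtx I dg aug)
    (hI : IsMonomialIdeal K n I) {i : ℕ} {l : Fin n → ℕ} (hext : IsExtremalPair K n I i l) :
    IsExtExtremalPair K n B Mtx dg i l := by
  refine ⟨hext.1, hext.2.1, hext.2.2.1, ?_, ?_⟩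
  · obtain ⟨b, σ, hb⟩ := (hres.torQDimSym_ne_zero_iff hI).1 hext.2.2.2.1
    refine ⟨l ∘ σ, ⟨σ, rfl⟩, Pi.single b 1, fun b' => ?_, ?_, fun hmem => ?_⟩
    · obtain rfl | hne := eq_or_ne b' b
      · rw [Pi.single_eq_same, ← MvPolynomial.C_1]
        exact isHomogZ_C (fun t => sub_eq_zero.2 (hb t)) 1
      · rw [Pi.single_eq_of_ne hne]
        intro e he
        simp at he
    · funext g
      change ∑ c, Mtx i g c * (Pi.single b 1 : B i → MvPolynomial (Fin n) K) c = 0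
      refine Finset.sum_eq_zero fun c _ => ?_
      obtain rfl | hne := eq_or_ne c b
      · rw [hext.entry_eq_zero hres hI hb, zero_mul]
      · rw [Pi.single_eq_of_ne hne, mul_zero]
    · have := hres.coeff_zero_of_mem_dualBd hmem b
      rw [Pi.single_eq_same] at this
      simp at this
  · rintro j μ hij - hlμ hne hsum ⟨_, ⟨σ, rfl⟩, hnz⟩
    obtain ⟨b, hb⟩ := hnz.exists_degree_le
    have hsum' : ∑ t, (μ t : ℤ) ≤ ∑ t, dg j b t := by
      rw [← sum_natCast_comp μ σ]
      exact Finset.sum_le_sum fun t _ => hb t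
    have hdeg := hext.degree_eq hres hI hij (b := b) (σ := σ)
      (fun t => (Nat.cast_le.2 (hlμ (σ t))).trans (hb t)) (by omega)
    refine hne (funext fun t => le_antisymm (hlμ t) ?_)
    have h₁ := hb (σ.symm t)
    rw [hdeg] at h₁
    simpa using h₁

theorem IsMinimalFreeResolution.exists_isExtremalPair
    (hres : IsMinimalFreeResolution K n B Mtx I dg aug) (hI : IsMonomialIdeal K n I)
    {i : ℕ} {l : Fin n → ℕ} (hi : 1 ≤ i) (hl : Antitone l) (hnz : torQDimSym K n I i l ≠ 0) :
    ∃ j μ, IsExtremalPair K n I j μ ∧ i ≤ j ∧ (∀ t, l t ≤ μ t) ∧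
      ∑ t, (l t : ℤ) - i ≤ ∑ t, (μ t : ℤ) - j := by
  obtain ⟨N, hN⟩ := (Set.finite_range fun x : Σ j : Fin (n + 1), B j =>
    ∑ t, dg x.1 x.2 t).bddAbove
  have hbound : ∀ j μ, torQDimSym K n I j μ ≠ 0 → ∑ t, (μ t : ℤ) ≤ N := fun j μ h => by
    obtain ⟨b, σ, hb⟩ := (hres.torQDimSym_ne_zero_iff hI).1 h
    rw [← sum_natCast_comp μ σ, ← Finset.sum_congr rfl fun t _ => hb t]
    exact hN ⟨⟨⟨j, Nat.lt_succ_of_le (le_of_torQDimSym_ne_zero h)⟩, b⟩, rfl⟩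
  obtain ⟨k, hk⟩ : ∃ k : ℕ, (N - ∑ t, (l t : ℤ)).toNat = k := ⟨_, rfl⟩
  induction k using Nat.strong_induction_on generalizing i l with
  | _ k ih =>
    by_cases hext : IsExtremalPair K n I i l
    · exact ⟨i, l, hext, le_rfl, fun _ => le_rfl, le_rfl⟩
    have hviol : ∃ (j : ℕ) (μ : Fin n → ℕ), i ≤ j ∧ Antitone μ ∧ (∀ t, l t ≤ μ t) ∧ l ≠ μ ∧
        ∑ t, (l t : ℤ) - i ≤ ∑ t, (μ t : ℤ) - j ∧ torQDimSym K n I j μ ≠ 0 := by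
      by_contra! h
      exact hext ⟨hi, le_of_torQDimSym_ne_zero hnz, hl, hnz, h⟩
    obtain ⟨j, μ, hij, hμ, hlμ, hne, hsum, hnz'⟩ := hviol
    have hlt : ∑ t, (l t : ℤ) < ∑ t, (μ t : ℤ) := by
      refine lt_of_le_of_ne (Finset.sum_le_sum fun t _ => Nat.cast_le.2 (hlμ t)) fun he => hne ?_
      exact funext fun t => Nat.cast_injective ((Finset.sum_eq_sum_iff_of_le
        fun t _ => Nat.cast_le.2 (hlμ t)).1 he t (Finset.mem_univ t))
    have hμN := hbound j μ hnz'
    obtain ⟨j', μ', hext', hjj', hμμ', hsum'⟩ :=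
      ih _ (by omega) (hi.trans hij) hμ hnz' rfl
    exact ⟨j', μ', hext', hij.trans hjj', fun t => (hlμ t).trans (hμμ' t), hsum.trans hsum'⟩

theorem IsExtExtremalPair.isExtremalPair (hres : IsMinimalFreeResolution K n B Mtx I dg aug)
    (hI : IsMonomialIdeal K n I) {i : ℕ} {l : Fin n → ℕ}
    (hext : IsExtExtremalPair K n B Mtx dg i l) : IsExtremalPair K n I i l := by
  have key : ∀ j μ, i ≤ j → Antitone μ → (∀ t, l t ≤ μ t) →
      ∑ t, (l t : ℤ) - i ≤ ∑ t, (μ t : ℤ) - j → torQDimSym K n I j μ ≠ 0 → l = μ := by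
    intro j μ hij hμ hlμ hsum hnz
    obtain ⟨j', μ', hext', hjj', hμμ', hsum'⟩ :=
      hres.exists_isExtremalPair hI (hext.1.trans hij) hμ hnz
    have hE := hext'.isExtExtremalPair hres hI
    have hlμ' : l = μ' := by
      by_contra hne
      exact hext.2.2.2.2 j' μ' (hij.trans hjj') hE.2.2.1 (fun t => (hlμ t).trans (hμμ' t)) hne
        (hsum.trans hsum') hE.2.2.2.1
    exact funext fun t => le_antisymm (hlμ t) (hlμ' ▸ hμμ' t)
  refine ⟨hext.1, hext.2.1, hext.2.2.1, ?_, fun j μ hij hμ hlμ hne hsum => ?_⟩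
  · obtain ⟨_, ⟨σ, rfl⟩, hnz⟩ := hext.2.2.2.1
    obtain ⟨b, hb⟩ := hnz.exists_degree_le
    have hb' : ∀ t, (l (σ t) : ℤ) ≤ dg i b t := hb
    obtain ⟨μ, hμ, hlμ, τ, hτ⟩ := exists_antitone_rearrangement (a := fun t => (dg i b t).toNat)
      hext.2.2.1 (σ := σ) fun t => by have := hb' t; omega
    have hnz' : torQDimSym K n I i μ ≠ 0 := by
      refine (hres.torQDimSym_ne_zero_iff hI).2 ⟨b, τ, fun t => ?_⟩
      have h₁ : (dg i b t).toNat = μ (τ t) := congrFun hτ t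
      have h₂ := hb' t
      omega
    rwa [key i μ le_rfl hμ hlμ
      (sub_le_sub_right (Finset.sum_le_sum fun t _ => Nat.cast_le.2 (hlμ t)) _) hnz']
  · by_contra hnz
    exact hne (key j μ hij hμ hlμ hsum hnz)

/-- Homogeneous vectors of extremal multidegree are constant, and supported on generators of
extremal degree. -/
theorem IsExtremalPair.eq_C_of_isHomogZ (hres : IsMinimalFreeResolution K n B Mtx I dg aug)
    (hI : IsMonomialIdeal K n I) {i : ℕ} {l : Fin n → ℕ} (hext : IsExtremalPair K n I i l)
    {b : B i} {f : MvPolynomial (Fin n) K}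
    (hf : IsHomogZ K n f fun t => dg i b t - (l t : ℤ)) (h0 : f ≠ 0) :
    (dg i b = fun t => (l t : ℤ)) ∧ f = MvPolynomial.C (MvPolynomial.coeff 0 f) := by
  have hle : ∀ t, (l t : ℤ) ≤ dg i b t := fun t => sub_nonneg.1 (hf.nonneg h0 t)
  have hdeg : ∀ t, dg i b t = l t := hext.degree_eq hres hI le_rfl (σ := 1) hle
    (sub_le_sub_right (Finset.sum_le_sum fun t _ => hle t) _)
  refine ⟨funext hdeg, ?_⟩
  ext e
  rw [MvPolynomial.coeff_C]
  split_ifs with he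
  · rw [he]
  · by_contra hne
    refine he (Eq.symm ?_)
    ext t
    have := hf e (MvPolynomial.mem_support_iff.2 hne) t
    simp only [hdeg, sub_self] at this
    exact_mod_cast this

theorem IsExtremalPair.finrank_extZ (hres : IsMinimalFreeResolution K n B Mtx I dg aug)
    (hI : IsMonomialIdeal K n I) {i : ℕ} {l : Fin n → ℕ} (hext : IsExtremalPair K n I i l) :
    finrank K (extZ K n B Mtx dg i fun t => (l t : ℤ)) =
      Nat.card {b : B i // dg i b = fun t => (l t : ℤ)} := by
  let Φ : extZ K n B Mtx dg i (fun t => (l t : ℤ)) →ₗ[K]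
      ({b : B i // dg i b = fun t => (l t : ℤ)} → K) :=
    (LinearMap.pi fun b => MvPolynomial.lcoeff K 0 ∘ₗ
      LinearMap.proj (R := K) (φ := fun _ : B i => MvPolynomial (Fin n) K) b.1) ∘ₗ
      Submodule.subtype _
  have hΦ : ∀ z b, Φ z b = MvPolynomial.coeff 0 (z.1 b.1) := fun _ _ => rfl
  have hbij : Function.Bijective Φ := by
    constructor
    · rw [← LinearMap.ker_eq_bot, LinearMap.ker_eq_bot']
      intro z hz
      refine Subtype.ext (funext fun b => ?_)
      by_contra hne
      obtain ⟨hb, hC⟩ := hext.eq_C_of_isHomogZ hres hI (z.2.1 b) hne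
      rw [← hΦ z ⟨b, hb⟩, hz] at hC
      exact hne (hC.trans (map_zero _))
    · intro w
      refine ⟨⟨fun b => if h : dg i b = fun t => (l t : ℤ) then MvPolynomial.C (w ⟨b, h⟩) else 0,
        fun b => ?_, ?_⟩, ?_⟩
      · beta_reduce
        split_ifs with h
        · exact isHomogZ_C (fun t => sub_eq_zero.2 (congrFun h t)) _
        · intro e he
          simp at he
      · funext g
        refine Finset.sum_eq_zero fun c _ => ?_
        beta_reduce
        split_ifs with h
        · rw [hext.entry_eq_zero hres hI (σ := 1) (congrFun h), zero_mul]
        · rw [mul_zero]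
      · funext b
        rw [hΦ]
        simp [b.2]
  rw [(LinearEquiv.ofBijective Φ hbij).finrank_eq, finrank_fintype_fun_eq_card,
    Nat.card_eq_fintype_card]

theorem IsExtremalPair.torQDim_eq_extDim (hres : IsMinimalFreeResolution K n B Mtx I dg aug)
    (hI : IsMonomialIdeal K n I) {i : ℕ} {l : Fin n → ℕ} (hext : IsExtremalPair K n I i l) :
    torQDim K n I i l = extDim K n B Mtx dg i fun t => (l t : ℤ) := by
  have hbot : (dualBd K n B Mtx i).restrictScalars K ⊓
      extZ K n B Mtx dg i (fun t => (l t : ℤ)) = ⊥ := by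
    rw [eq_bot_iff]
    rintro z ⟨hbd, hz⟩
    refine (Submodule.mem_bot _).2 (funext fun b => ?_)
    by_contra hne
    have hC := (hext.eq_C_of_isHomogZ hres hI (hz.1 b) hne).2
    rw [hres.coeff_zero_of_mem_dualBd hbd, map_zero] at hC
    exact hne hC
  rw [extDim, hbot, finrank_bot, Nat.sub_zero, hext.finrank_extZ hres hI,
    hres.torQDim_eq_card hI]

end Extremal

/-- Let `I` be an `S_n`-invariant monomial ideal.  A pair
`(i, λ) ∈ [n] × P_n` is extremal in the Betti table of `R/I` if and only if it is
Ext-extremal; moreover, for an extremal pair `(i, λ)`,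
`β_{i,λ}(R/I) = dim_k Ext^i(R/I, R)_{-λ}`
(`Ext` being computed from any minimal `ℤ^n`-graded free resolution of `R/I`). -/
theorem statement_15 (K : Type) [Field K] (n : ℕ)
    (I : Ideal (MvPolynomial (Fin n) K))
    (hmon : IsMonomialIdeal K n I) (hsym : IsSymmetricIdeal K n I)
    (B : ℕ → Type) [∀ i, Fintype (B i)]
    (Mtx : ∀ i, B (i + 1) → B i → MvPolynomial (Fin n) K)
    (dg : ∀ i, B i → Fin n → ℤ) (aug : B 0 → MvPolynomial (Fin n) K)
    (hres : IsMinimalFreeResolution K n B Mtx I dg aug) :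
    ∀ (i : ℕ) (lam : Fin n → ℕ),
      (IsExtremalPair K n I i lam ↔ IsExtExtremalPair K n B Mtx dg i lam) ∧
      (IsExtremalPair K n I i lam →
        torQDim K n I i lam = extDim K n B Mtx dg i (fun t => (lam t : ℤ))) := by
  intro i lam
  exact ⟨⟨fun h => h.isExtExtremalPair hres hmon, fun h => h.isExtremalPair hres hmon⟩,
    fun h => h.torQDim_eq_extDim hres hmon⟩
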